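/- arXiv:2402.00590 — 8 statements merged into one kernel-verified Lean document; each statement's English description precedes it below -/
import Mathlib

section
/- Let G be a finite connected simple graph with no full vertex, and let X = {v ∈ V(G) : G − v is not connected} be the set of cut vertices of G. Then CC(G) = 2 if and only if X is a connected dominating set of G. -/
open SimpleGraph

section Defs

variable {V W : Type*}

/-- A full vertex: adjacent to every other vertex. -/
def IsFullVertex (G : SimpleGraph V) (v : V) : Prop :=
  ∀ w, w ≠ v → G.Adj v w

/-- A dominating set: every vertex outside `S` has a neighbor in `S`. -/
def IsDomSet (G : SimpleGraph V) (S : Set V) : Prop :=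
  ∀ v, v ∉ S → ∃ u ∈ S, G.Adj u v

/-- A connected dominating set: a dominating set inducing a connected subgraph. -/
def IsCDS (G : SimpleGraph V) (S : Set V) : Prop :=
  IsDomSet G S ∧ (G.induce S).Connected

/-- Two disjoint sets form a connected coalition: their union is a connected dominating
set, but neither of them is one. -/
def IsConnCoalition (G : SimpleGraph V) (A B : Set V) : Prop :=
  Disjoint A B ∧ ¬ IsCDS G A ∧ ¬ IsCDS G B ∧ IsCDS G (A ∪ B)

/-- A connected coalition partition: a partition of the vertex set in which every block
is either a singleton full vertex, or forms a connected coalition with another block. -/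
def IsCCPartition (G : SimpleGraph V) (Φ : Set (Set V)) : Prop :=
  Setoid.IsPartition Φ ∧
    ∀ A ∈ Φ, (∃ v, A = {v} ∧ IsFullVertex G v) ∨
      ∃ B ∈ Φ, B ≠ A ∧ IsConnCoalition G A B

/-- The connected coalition number: the maximum cardinality of a connected coalition
partition (`0` if none exists). -/
noncomputable def CC (G : SimpleGraph V) : ℕ :=
  sSup {n : ℕ | ∃ Φ : Set (Set V), IsCCPartition G Φ ∧ Φ.ncard = n}

/-- A cut vertex: deleting it disconnects the graph. -/
def IsCutVertex (G : SimpleGraph V) (v : V) : Prop :=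
  ¬ (G.induce {w | w ≠ v}).Connected

end Defs



theorem IsCDS.superset {V : Type*} {G : SimpleGraph V} {S T : Set V} (h : IsCDS G S)
    (hST : S ⊆ T) : IsCDS G T := by
  obtain ⟨hd, hc⟩ := h
  refine ⟨fun v hv => ?_, ?_⟩
  · obtain ⟨u, hu, ha⟩ := hd v (fun h => hv (hST h))
    exact ⟨u, hST hu, ha⟩
  · obtain ⟨⟨s0, hs0⟩⟩ := hc.nonempty
    have key : ∀ s (hs : s ∈ S), (G.induce T).Reachable ⟨s0, hST hs0⟩ ⟨s, hST hs⟩ := by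
      intro s hs
      exact (hc.preconnected ⟨s0, hs0⟩ ⟨s, hs⟩).map (G.induceHomOfLE hST).toHom
    rw [SimpleGraph.connected_iff_exists_forall_reachable]
    refine ⟨⟨s0, hST hs0⟩, ?_⟩
    rintro ⟨t, ht⟩
    by_cases hts : t ∈ S
    · exact key t hts
    · obtain ⟨u, hu, ha⟩ := hd t hts
      refine (key u hu).trans (SimpleGraph.Adj.reachable ?_)
      simpa using ha

theorem cut_mem_cds {V : Type*} {G : SimpleGraph V} {S : Set V} (h : IsCDS G S) {v : V}
    (hv : IsCutVertex G v) : v ∈ S := by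
  by_contra hvS
  exact hv (h.superset (T := {w | w ≠ v}) (by rintro w hw rfl; exact hvS hw)).2

theorem singleton_not_cds {V : Type*} {G : SimpleGraph V} {v : V} (h : ¬ IsFullVertex G v) :
    ¬ IsCDS G {v} := by
  rintro ⟨hd, -⟩
  apply h
  intro w hw
  obtain ⟨u, hu, ha⟩ := hd w (by simpa using hw)
  rw [Set.mem_singleton_iff] at hu
  rwa [hu] at ha

theorem univ_cds {V : Type*} {G : SimpleGraph V} (hconn : G.Connected) :
    IsCDS G Set.univ :=
  ⟨fun v hv => absurd (Set.mem_univ v) hv, (SimpleGraph.induceUnivIso G).connected_iff.2 hconn⟩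

theorem compl_cds {V : Type*} {G : SimpleGraph V} (hconn : G.Connected) {v : V}
    (h : ¬ IsFullVertex G v) (hv : ¬ IsCutVertex G v) : IsCDS G {w | w ≠ v} := by
  refine ⟨?_, not_not.1 hv⟩
  intro x hx
  have hx : x = v := by simpa using hx
  subst hx
  obtain ⟨w, hw⟩ : ∃ w, w ≠ x := by
    by_contra! hc
    exact h fun w hw => absurd (hc w) hw
  haveI : Nontrivial V := ⟨w, x, hw⟩
  obtain ⟨u, hu⟩ := hconn.preconnected.exists_adj_of_nontrivial x
  exact ⟨u, hu.ne', hu.symm⟩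

/-- The partition into `A` and singletons outside `A`. -/
theorem exists_partition {V : Type*} [Finite V] (G : SimpleGraph V)
    (hfull : ∀ v, ¬ IsFullVertex G v) (A : Set V) (hne : A.Nonempty) (hA : ¬ IsCDS G A)
    (hmax : ∀ v, v ∉ A → IsCDS G (A ∪ {v})) (hc : Aᶜ.Nonempty) :
    ∃ Φ : Set (Set V), IsCCPartition G Φ ∧ Φ.ncard = Aᶜ.ncard + 1 := by
  have hnot : A ∉ (fun v => ({v} : Set V)) '' Aᶜ := by
    rintro ⟨v, hv, rfl⟩
    exact hv rfl
  refine ⟨insert A ((fun v => ({v} : Set V)) '' Aᶜ), ⟨⟨?_, ?_⟩, ?_⟩, ?_⟩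
  · rintro (h | ⟨v, -, h⟩)
    · exact hne.ne_empty h.symm
    · exact Set.singleton_ne_empty v h
  · intro a
    by_cases ha : a ∈ A
    · refine ⟨A, ⟨Or.inl rfl, ha⟩, ?_⟩
      rintro B ⟨rfl | ⟨v, hv, rfl⟩, hB⟩
      · rfl
      · obtain rfl : a = v := hB
        exact absurd ha hv
    · refine ⟨{a}, ⟨Or.inr ⟨a, ha, rfl⟩, rfl⟩, ?_⟩
      rintro B ⟨rfl | ⟨v, hv, rfl⟩, hB⟩
      · exact absurd hB ha
      · obtain rfl : a = v := hB
        rfl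
  · rintro B (rfl | ⟨v, hv, rfl⟩)
    · obtain ⟨v, hv⟩ := hc
      refine Or.inr ⟨{v}, Or.inr ⟨v, hv, rfl⟩, ?_, ?_, hA, singleton_not_cds (hfull v), hmax v hv⟩
      · rintro rfl
        exact hv rfl
      · simpa using hv
    · refine Or.inr ⟨A, Or.inl rfl, ?_, ?_, singleton_not_cds (hfull v), hA, ?_⟩
      · rintro rfl
        exact hv rfl
      · simpa using hv
      · rw [Set.union_comm]
        exact hmax v hv
  · rw [Set.ncard_insert_of_notMem hnot (Set.toFinite _),
      Set.ncard_image_of_injective _ Set.singleton_injective]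

theorem cc_bdd {V : Type*} [Finite V] (G : SimpleGraph V) :
    BddAbove {n : ℕ | ∃ Φ : Set (Set V), IsCCPartition G Φ ∧ Φ.ncard = n} := by
  refine ⟨Nat.card (Set V), ?_⟩
  rintro n ⟨Φ, -, rfl⟩
  rw [← Set.ncard_univ]
  exact Set.ncard_le_ncard (Set.subset_univ _) (Set.toFinite _)

/-- For a finite connected graph `G` with no full vertex,
`CC(G) = 2` iff the set of cut vertices is a connected dominating set. -/
theorem cc_eq_two_iff_cutvertices_cds {V : Type*} [Fintype V] (G : SimpleGraph V)
    (hconn : G.Connected) (hfull : ∀ v, ¬ IsFullVertex G v) :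
    CC G = 2 ↔ IsCDS G {v | IsCutVertex G v} := by
  constructor
  · intro h2
    by_contra hX
    obtain ⟨A, hXA, hAmax⟩ := Set.Finite.exists_le_maximal
      (Set.toFinite {S : Set V | ¬ IsCDS G S}) (a := {v | IsCutVertex G v}) hX
    have hA : ¬ IsCDS G A := hAmax.prop
    have hmax : ∀ v, v ∉ A → IsCDS G (A ∪ {v}) := by
      intro v hv
      by_contra hc
      exact hv (hAmax.le_of_ge (y := A ∪ {v}) hc Set.subset_union_left (Or.inr rfl))
    have hne : A.Nonempty := by
      by_contra he
      rw [Set.not_nonempty_iff_eq_empty] at he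
      obtain ⟨v⟩ := hconn.nonempty
      have := hmax v (by simp [he])
      rw [he, Set.empty_union] at this
      exact singleton_not_cds (hfull v) this
    obtain ⟨v, hv⟩ : Aᶜ.Nonempty := by
      rw [Set.nonempty_compl]
      rintro rfl
      exact hA (univ_cds hconn)
    have hvc : ¬ IsCutVertex G v := fun h => hv (hXA h)
    obtain ⟨w, hw, hwv⟩ : ∃ w, w ∉ A ∧ w ≠ v := by
      by_contra! hc
      refine hA ((compl_cds hconn (hfull v) hvc).superset ?_)
      intro w hw
      by_contra hwA
      exact hw (hc w hwA)
    obtain ⟨Φ, hΦ, hcard⟩ := exists_partition G hfull A hne hA hmax ⟨v, hv⟩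
    have h1 : 1 < Aᶜ.ncard := (Set.one_lt_ncard (Set.toFinite _)).2 ⟨w, hw, v, hv, hwv⟩
    have h3 : Φ.ncard ≤ CC G := le_csSup (cc_bdd G) ⟨Φ, hΦ, rfl⟩
    omega
  · intro hX
    have hle : ∀ Φ : Set (Set V), IsCCPartition G Φ → Φ.ncard ≤ 2 := by
      rintro Φ ⟨hP, hΦ⟩
      have hΦ' : ∀ A ∈ Φ, ∃ B ∈ Φ, B ≠ A ∧ IsConnCoalition G A B := by
        intro A hA
        rcases hΦ A hA with ⟨v, -, hv⟩ | h
        · exact absurd hv (hfull v)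
        · exact h
      have hdisj : ∀ A ∈ Φ, ∀ B ∈ Φ, ∀ x, x ∈ A → x ∈ B → A = B := by
        intro A hA B hB x hxA hxB
        exact (hP.2 x).unique ⟨hA, hxA⟩ ⟨hB, hxB⟩
      obtain ⟨v⟩ := hconn.nonempty
      obtain ⟨A, ⟨hA, -⟩, -⟩ := hP.2 v
      obtain ⟨B, hB, hBA, -, hnA, hnB, hAB⟩ := hΦ' A hA
      obtain ⟨x, hx, hxB⟩ : ∃ x, IsCutVertex G x ∧ x ∉ B := by
        by_contra! hc
        exact hnB (hX.superset hc)
      obtain ⟨y, hy, hyA⟩ : ∃ x, IsCutVertex G x ∧ x ∉ A := by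
        by_contra! hc
        exact hnA (hX.superset hc)
      have hxA : x ∈ A := (cut_mem_cds hAB hx).resolve_right hxB
      have hyB : y ∈ B := (cut_mem_cds hAB hy).resolve_left hyA
      have hsub : Φ ⊆ {A, B} := by
        intro C hC
        obtain ⟨D, hD, hDC, -, -, -, hCD⟩ := hΦ' C hC
        rcases cut_mem_cds hCD hx with h1 | h1
        · exact Or.inl (hdisj C hC A hA x h1 hxA)
        · rcases cut_mem_cds hCD hy with h2 | h2
          · exact Or.inr (hdisj C hC B hB y h2 hyB)
          · exact absurd ((hdisj B hB D hD y hyB h2).trans (hdisj D hD A hA x h1 hxA)) hBA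
      exact (Set.ncard_le_ncard hsub (Set.toFinite _)).trans (Set.ncard_pair (Ne.symm hBA)).le
    obtain ⟨⟨x, hx⟩⟩ := hX.2.nonempty
    have hcompl : ({w | w ≠ x} : Set V)ᶜ = {x} := by
      ext w
      simp
    obtain ⟨Φ, hΦ, hcard⟩ := exists_partition G hfull {w | w ≠ x}
      (by
        by_contra hc
        apply hfull x
        intro w hw
        exact absurd ⟨w, hw⟩ hc)
      (fun h => hx h.2)
      (by
        intro v hv
        have hv : v = x := by simpa using hv
        subst hv
        refine (univ_cds hconn).superset ?_
        intro w _
        by_cases h : w = v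
        · exact Or.inr h
        · exact Or.inl h)
      (by rw [hcompl]; exact Set.singleton_nonempty x)
    rw [hcompl, Set.ncard_singleton] at hcard
    apply le_antisymm
    · refine csSup_le ⟨_, Φ, hΦ, rfl⟩ ?_
      rintro n ⟨Ψ, hΨ, rfl⟩
      exact hle Ψ hΨ
    · exact le_csSup (cc_bdd G) ⟨Φ, hΦ, hcard⟩
end

section
/- For any tree T (a finite connected acyclic simple graph) with no full vertex, CC(T) = 2. -/
open SimpleGraph

/-- Internal vertices: those with two distinct neighbours. -/
def Internal {V : Type*} (T : SimpleGraph V) : Set V :=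
  {v | ∃ a b, a ≠ b ∧ T.Adj v a ∧ T.Adj v b}

lemma internal_mem_cds {V : Type*} (T : SimpleGraph V) (hT : T.IsTree) (S : Set V)
    (hS : IsCDS T S) : Internal T ⊆ S := by
  rintro v ⟨a, b, hab, ha, hb⟩
  by_contra hv
  have key : ∀ c, T.Adj v c → ∃ c' ∈ S, ∃ p : T.Walk c c', v ∉ p.support := by
    intro c hc
    by_cases h : c ∈ S
    · exact ⟨c, h, Walk.nil, by simpa using hc.ne⟩
    · obtain ⟨u, hu, huc⟩ := hS.1 c h
      refine ⟨u, hu, Walk.cons huc.symm Walk.nil, ?_⟩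
      have : v ≠ u := fun e => hv (e ▸ hu)
      simp [hc.ne, this]
  obtain ⟨a', ha', p, hp⟩ := key a ha
  obtain ⟨b', hb', q, hq⟩ := key b hb
  obtain ⟨r⟩ := hS.2.preconnected ⟨a', ha'⟩ ⟨b', hb'⟩
  let r' : T.Walk a' b' := r.map (Embedding.induce S).toHom
  have hr : v ∉ r'.support := by
    intro h
    have h2 : v ∈ r.support.map (Embedding.induce (G := T) S).toHom := by
      rw [← Walk.support_map]
      exact h
    obtain ⟨x, -, hx⟩ := List.mem_map.1 h2
    exact hv (hx ▸ x.2)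
  let w : T.Walk a b := p.append (r'.append q.reverse)
  have hw : v ∉ w.support := by
    simp [w, Walk.mem_support_append_iff, hp, hq, hr]
  classical
  have hw2 : v ∉ w.bypass.support := fun h => hw (w.support_bypass_subset_support h)
  let z : T.Walk a b := Walk.cons ha.symm (Walk.cons hb Walk.nil)
  have hz : z.IsPath := by
    simp [z, Walk.cons_isPath_iff, hab, ha.ne.symm, hb.ne]
  have e := hT.isAcyclic.path_unique ⟨w.bypass, w.bypass_isPath⟩ ⟨z, hz⟩
  have e' : w.bypass = z := congrArg Subtype.val e
  rw [e'] at hw2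
  simp [z] at hw2

lemma path_reachable {V : Type*} (T : SimpleGraph V) (S : Set V) (hS : Internal T ⊆ S)
    {x y : V} (p : T.Walk x y) (hp : p.IsPath) (hx : x ∈ S) (hy : y ∈ S) :
    (T.induce S).Reachable ⟨x, hx⟩ ⟨y, hy⟩ := by
  induction p with
  | nil => exact Reachable.refl _
  | @cons x u y h q ih =>
    rw [Walk.cons_isPath_iff] at hp
    have hu : u ∈ S := by
      cases q with
      | nil => exact hy
      | @cons _ w _ h' r =>
        refine hS ⟨x, w, ?_, h.symm, h'⟩
        rintro rfl
        exact hp.2 (by simp)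
    have hadj : (T.induce S).Adj ⟨x, hx⟩ ⟨u, hu⟩ := h
    exact hadj.reachable.trans (ih hp.1 hu hy)

lemma cds_of_internal {V : Type*} (T : SimpleGraph V) (hT : T.IsTree)
    (hfull : ∀ v, ¬ IsFullVertex T v) (S : Set V) (hS : Internal T ⊆ S) : IsCDS T S := by
  have hdom : IsDomSet T S := by
    intro v hv
    by_contra! hno
    -- every neighbour of v is outside S
    obtain ⟨x, hx, hxv⟩ : ∃ x, x ≠ v ∧ ¬ T.Adj v x := by
      have := hfull v
      unfold IsFullVertex at this
      push Not at this
      exact this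
    obtain ⟨p, hp⟩ := (hT.connected v x).exists_isPath
    cases p with
    | nil => exact hx rfl
    | @cons _ u _ h q =>
      rw [Walk.cons_isPath_iff] at hp
      cases q with
      | nil => exact hxv h
      | @cons _ w _ h' r =>
        refine hno u (hS ⟨v, w, ?_, h.symm, h'⟩) h.symm
        rintro rfl
        exact hp.2 (by simp)
  refine ⟨hdom, ?_⟩
  have hne : S.Nonempty := by
    obtain ⟨v⟩ := hT.connected.nonempty
    by_cases h : v ∈ S
    · exact ⟨v, h⟩
    · obtain ⟨u, hu, -⟩ := hdom v h
      exact ⟨u, hu⟩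
  have : Nonempty S := hne.to_subtype
  refine ⟨?_⟩
  rintro ⟨x, hx⟩ ⟨y, hy⟩
  obtain ⟨p, hp⟩ := (hT.connected x y).exists_isPath
  exact path_reachable T S hS p hp hx hy

/-- Every tree with no full vertex has connected coalition number 2. -/
theorem cc_tree_eq_two {V : Type*} [Fintype V] (T : SimpleGraph V) (hT : T.IsTree)
    (hfull : ∀ v, ¬ IsFullVertex T v) :
    CC T = 2 := by
  obtain ⟨v, hv⟩ : (Internal T).Nonempty := by
    by_contra h
    rw [Set.not_nonempty_iff_eq_empty] at h
    have := (cds_of_internal T hT hfull ∅ (by rw [h])).2.nonempty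
    simp at this
  apply IsGreatest.csSup_eq
  constructor
  · have h1 : ¬ IsCDS T {v} := by
      intro h
      apply hfull v
      intro w hw
      obtain ⟨u, hu, huw⟩ := h.1 w hw
      rw [Set.mem_singleton_iff] at hu
      exact hu ▸ huw
    have h2 : ¬ IsCDS T {v}ᶜ := fun h => internal_mem_cds T hT _ h hv rfl
    have h3 : IsCDS T Set.univ := cds_of_internal T hT hfull _ (Set.subset_univ _)
    have hne : ({v} : Set V) ≠ {v}ᶜ := by
      intro h
      have : v ∈ ({v} : Set V)ᶜ := h ▸ Set.mem_singleton v
      exact this rfl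
    have hcne : (∅ : Set V) ≠ {v}ᶜ := by
      intro h
      apply hfull v
      intro w hw
      have : w ∈ (∅ : Set V) := by rw [h]; exact hw
      exact this.elim
    refine ⟨{{v}, {v}ᶜ}, ⟨⟨?_, ?_⟩, ?_⟩, Set.ncard_pair hne⟩
    · rintro (h | h)
      · exact Set.singleton_ne_empty v h.symm
      · exact hcne h
    · intro a
      by_cases ha : a = v
      · refine ⟨{v}, ⟨by simp, ha⟩, ?_⟩
        rintro B ⟨rfl | rfl, hB⟩
        · rfl
        · exact (hB ha).elim
      · refine ⟨{v}ᶜ, ⟨by simp, ha⟩, ?_⟩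
        rintro B ⟨rfl | rfl, hB⟩
        · exact (ha hB).elim
        · rfl
    · rintro A (rfl | rfl)
      · exact Or.inr ⟨{v}ᶜ, by simp, hne.symm, disjoint_compl_right, h1, h2,
          by rwa [Set.union_compl_self]⟩
      · exact Or.inr ⟨{v}, by simp, hne, disjoint_compl_left, h2, h1,
          by rwa [Set.compl_union_self]⟩
  · rintro n ⟨Φ, ⟨hΦ, hc⟩, rfl⟩
    have hco : ∀ A ∈ Φ, ∃ B ∈ Φ, ¬ IsCDS T A ∧ Internal T ⊆ A ∪ B := by
      intro A hA
      rcases hc A hA with ⟨u, -, hu⟩ | ⟨B, hB, -, -, hA', -, hAB⟩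
      · exact (hfull u hu).elim
      · exact ⟨B, hB, hA', internal_mem_cds T hT _ hAB⟩
    have huniq : ∀ x, ∀ A ∈ Φ, ∀ B ∈ Φ, x ∈ A → x ∈ B → A = B :=
      fun x A hA B hB h h' => (hΦ.2 x).unique ⟨hA, h⟩ ⟨hB, h'⟩
    obtain ⟨A, ⟨hA, hvA⟩, -⟩ := hΦ.2 v
    obtain ⟨B, hB, hA', hAB⟩ := hco A hA
    obtain ⟨w, hw, hwA⟩ : ∃ w ∈ Internal T, w ∉ A := by
      by_contra! h
      exact hA' (cds_of_internal T hT hfull A h)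
    have hwB : w ∈ B := (hAB hw).resolve_left hwA
    have hsub : Φ ⊆ {A, B} := by
      intro C hC
      by_contra hne
      simp only [Set.mem_insert_iff, Set.mem_singleton_iff, not_or] at hne
      obtain ⟨D, hD, -, hCD⟩ := hco C hC
      have hvD : v ∈ D := (hCD hv).resolve_left fun h => hne.1 (huniq v C hC A hA h hvA)
      have hwD : w ∈ D := (hCD hw).resolve_left fun h => hne.2 (huniq w C hC B hB h hwB)
      exact hwA (huniq v D hD A hA hvD hvA ▸ hwD)
    exact (Set.ncard_le_ncard hsub (Set.toFinite _)).trans ((Set.ncard_insert_le A {B}).trans (by simp))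
end

section
/- Let G be a unicyclic graph of order n ≥ 5 (a connected graph containing exactly one cycle) with no full vertex, whose unique cycle is C_m, and let Y = {v ∈ V(C_m) : G − v is connected}. If Y contains two non-adjacent vertices (equivalently, |Y| ≥ 2 and the induced subgraph G[Y] is not K₂), then CC(G) = 3. -/
open SimpleGraph

namespace CCU

variable {V : Type*}

/-- Transfer of connectivity along a map sending adjacent vertices to reachable ones. -/
lemma connected_transfer {W X : Type*} {H : SimpleGraph W} {K : SimpleGraph X}
    (hH : H.Connected) (f : W → X) (hf : ∀ u v, H.Adj u v → K.Reachable (f u) (f v))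
    (hs : ∀ x, ∃ w, K.Reachable x (f w)) : K.Connected := by
  have key : ∀ u v, H.Reachable u v → K.Reachable (f u) (f v) := by
    rintro u v ⟨p⟩
    induction p with
    | nil => exact Reachable.refl _
    | cons h _ ih => exact (hf _ _ h).trans ih
  obtain ⟨w⟩ := hH.nonempty
  have : Nonempty X := ⟨f w⟩
  refine Connected.mk ?_
  intro x y
  obtain ⟨u, hu⟩ := hs x
  obtain ⟨v, hv⟩ := hs y
  exact hu.trans ((key u v (hH.preconnected u v)).trans hv.symm)

lemma cds_mono {G : SimpleGraph V} {S T : Set V} (hS : IsCDS G S) (hST : S ⊆ T) :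
    IsCDS G T := by
  classical
  refine ⟨?_, ?_⟩
  · intro v hv
    obtain ⟨u, hu, h⟩ := hS.1 v (fun h => hv (hST h))
    exact ⟨u, hST hu, h⟩
  · refine connected_transfer hS.2 (fun u => (⟨u.1, hST u.2⟩ : T)) ?_ ?_
    · intro u v h
      exact Adj.reachable (by simpa using h)
    · rintro ⟨x, hx⟩
      by_cases hxS : x ∈ S
      · exact ⟨⟨x, hxS⟩, Reachable.refl _⟩
      · obtain ⟨u, hu, h⟩ := hS.1 x hxS
        exact ⟨⟨u, hu⟩, Adj.reachable (by simpa using h.symm)⟩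

lemma closed_univ {G : SimpleGraph V} (hG : G.Connected) (S : Set V) {s : V} (hs : s ∈ S)
    (hc : ∀ u v, u ∈ S → G.Adj u v → v ∈ S) (z : V) : z ∈ S := by
  obtain ⟨p⟩ := hG.preconnected s z
  induction p with
  | nil => exact hs
  | cons h _ ih => exact ih (hc _ _ hs h)

lemma edge_count [Fintype V] (G : SimpleGraph V)
    (huni : G.edgeSet.ncard = Fintype.card V) (S : Set V) (hS : (G.induce S).Connected)
    (F : Set (Sym2 V)) (hF : F ⊆ G.edgeSet) (hFS : ∀ e ∈ F, ∃ v ∈ e, v ∉ S) :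
    S.ncard + F.ncard ≤ Fintype.card V + 1 := by
  classical
  have h1 := hS.card_vert_le_card_edgeSet_add_one
  set E := (Sym2.map (Subtype.val : S → V)) '' (G.induce S).edgeSet with hE
  have hEc : E.ncard = Nat.card (G.induce S).edgeSet := by
    rw [hE, Set.ncard_image_of_injective _ (Sym2.map.injective Subtype.val_injective)]
    rfl
  have hEG : E ⊆ G.edgeSet := by
    rintro _ ⟨e, he, rfl⟩
    induction e with
    | _ u v => simpa using he
  have hd : Disjoint E F := by
    rw [Set.disjoint_left]
    rintro _ ⟨e, he, rfl⟩ hf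
    obtain ⟨v, hv, hvS⟩ := hFS _ hf
    rw [Sym2.mem_map] at hv
    obtain ⟨w, _, rfl⟩ := hv
    exact hvS w.2
  have h2 : (E ∪ F).ncard ≤ G.edgeSet.ncard :=
    Set.ncard_le_ncard (Set.union_subset hEG hF) (Set.toFinite _)
  rw [Set.ncard_union_eq hd (Set.toFinite _) (Set.toFinite _), huni] at h2
  have h3 : S.ncard = Nat.card S := rfl
  omega

lemma inc_ncard [Fintype V] (G : SimpleGraph V) (v : V) :
    (G.incidenceSet v).ncard = (G.neighborSet v).ncard := by
  classical
  exact Nat.card_congr (G.incidenceSetEquivNeighborSet v)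

lemma deg_le_two [Fintype V] (G : SimpleGraph V)
    (huni : G.edgeSet.ncard = Fintype.card V) (v : V)
    (hS : (G.induce {w | w ≠ v}).Connected) : (G.neighborSet v).ncard ≤ 2 := by
  classical
  have h := edge_count G huni _ hS (G.incidenceSet v) (G.incidenceSet_subset v)
    (fun e he => ⟨v, he.2, by simp⟩)
  have h1 : ({w | w ≠ v} : Set V).ncard + ({v} : Set V).ncard = Fintype.card V := by
    have := Set.ncard_add_ncard_compl ({v} : Set V)
    rw [Nat.card_eq_fintype_card] at this
    rw [add_comm]; exact this
  rw [Set.ncard_singleton] at h1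
  rw [inc_ncard] at h
  omega

/-- Two non-adjacent vertices of degree at least two separate. -/
lemma not_conn_pair [Fintype V] (G : SimpleGraph V)
    (huni : G.edgeSet.ncard = Fintype.card V) (p q : V) (hpq : p ≠ q) (hadj : ¬ G.Adj p q)
    (hp : 2 ≤ (G.neighborSet p).ncard) (hq : 2 ≤ (G.neighborSet q).ncard) :
    ¬ (G.induce ({p, q}ᶜ : Set V)).Connected := by
  classical
  intro hS
  have h := edge_count G huni _ hS (G.incidenceSet p ∪ G.incidenceSet q)
    (Set.union_subset (G.incidenceSet_subset p) (G.incidenceSet_subset q))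
    (by
      rintro e (he | he)
      · exact ⟨p, he.2, by simp⟩
      · exact ⟨q, he.2, by simp⟩)
  have hd : Disjoint (G.incidenceSet p) (G.incidenceSet q) := by
    rw [Set.disjoint_left]
    intro e h1 h2
    have : e = s(p, q) := (Sym2.mem_and_mem_iff hpq).1 ⟨h1.2, h2.2⟩
    rw [this] at h1
    exact hadj h1.1
  rw [Set.ncard_union_eq hd (Set.toFinite _) (Set.toFinite _), inc_ncard, inc_ncard] at h
  have := Set.ncard_add_ncard_compl ({p, q} : Set V)
  rw [Nat.card_eq_fintype_card, Set.ncard_pair hpq] at this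
  omega

/-- No three vertices of degree at least two are pairwise avoidable by connected
dominating sets. -/
lemma no_triple [Fintype V] (G : SimpleGraph V)
    (hconn : G.Connected) (hn : 5 ≤ Fintype.card V)
    (huni : G.edgeSet.ncard = Fintype.card V) (p q r : V)
    (hpq : p ≠ q) (hpr : p ≠ r) (hqr : q ≠ r)
    (hp : 2 ≤ (G.neighborSet p).ncard) (hq : 2 ≤ (G.neighborSet q).ncard)
    (hr : 2 ≤ (G.neighborSet r).ncard)
    (h1 : ∃ S, IsCDS G S ∧ p ∉ S ∧ q ∉ S) (h2 : ∃ S, IsCDS G S ∧ p ∉ S ∧ r ∉ S)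
    (h3 : ∃ S, IsCDS G S ∧ q ∉ S ∧ r ∉ S) : False := by
  classical
  have adj : ∀ u v, u ≠ v → 2 ≤ (G.neighborSet u).ncard → 2 ≤ (G.neighborSet v).ncard →
      (∃ S, IsCDS G S ∧ u ∉ S ∧ v ∉ S) → G.Adj u v := by
    rintro u v huv hu hv ⟨S, hS, huS, hvS⟩
    by_contra hc
    refine not_conn_pair G huni u v huv hc hu hv (cds_mono hS ?_).2
    intro z hz
    simp only [Set.mem_compl_iff, Set.mem_insert_iff, Set.mem_singleton_iff]
    rintro (rfl | rfl) <;> contradiction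
  have deg : ∀ u, (∃ S, IsCDS G S ∧ u ∉ S) → (G.neighborSet u).ncard ≤ 2 := by
    rintro u ⟨S, hS, huS⟩
    refine deg_le_two G huni u (cds_mono hS ?_).2
    rintro z hz rfl
    exact huS hz
  have apq := adj p q hpq hp hq h1
  have apr := adj p r hpr hp hr h2
  have aqr := adj q r hqr hq hr h3
  have nb : ∀ u v w, v ≠ w → G.Adj u v → G.Adj u w → (G.neighborSet u).ncard ≤ 2 →
      ∀ z, G.Adj u z → z = v ∨ z = w := by
    intro u v w hvw huv huw hd z hz
    have : ({v, w} : Set V) = G.neighborSet u := by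
      apply Set.eq_of_subset_of_ncard_le
      · rintro x (rfl | rfl)
        · exact huv
        · exact huw
      · rw [Set.ncard_pair hvw]; exact hd
      · exact Set.toFinite _
    have hz' : z ∈ ({v, w} : Set V) := by rw [this]; exact hz
    simpa using hz'
  have np := nb p q r hqr apq apr (deg p (by obtain ⟨S, a, b, c⟩ := h1; exact ⟨S, a, b⟩))
  have nq := nb q p r hpr apq.symm aqr (deg q (by obtain ⟨S, a, b, c⟩ := h1; exact ⟨S, a, c⟩))
  have nr := nb r p q hpq apr.symm aqr.symm
    (deg r (by obtain ⟨S, a, b, c⟩ := h2; exact ⟨S, a, c⟩))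
  have all := closed_univ hconn ({p, q, r} : Set V) (s := p) (by simp) (by
    rintro u v (rfl | rfl | rfl) huv
    · rcases np v huv with rfl | rfl <;> simp
    · rcases nq v huv with rfl | rfl <;> simp
    · rcases nr v huv with rfl | rfl <;> simp)
  have hcard : Fintype.card V ≤ ({p, q, r} : Finset V).card := by
    rw [← Finset.card_univ]
    apply Finset.card_le_card
    intro z _
    simpa using all z
  have := Finset.card_le_three (a := p) (b := q) (c := r)
  omega

/-- Removing a set of leaves hanging at `A` keeps a connected dominating set. -/
lemma remove_leaves (G : SimpleGraph V) (A B : Set V) (hAB : IsCDS G (A ∪ B))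
    (hd : Disjoint A B) (hleaf : ∀ u ∈ B, ∃ w ∈ A, ∀ z, G.Adj u z ↔ z = w) : IsCDS G A := by
  classical
  choose! r hrA hr using hleaf
  have hdj : ∀ z, z ∈ A → z ∈ B → False := fun z h1 h2 => (Set.disjoint_left.1 hd) h1 h2
  constructor
  · intro z hz
    by_cases hzB : z ∈ B
    · exact ⟨r z, hrA z hzB, ((hr z hzB _).2 rfl).symm⟩
    · obtain ⟨u, hu | hu, h⟩ := hAB.1 z (by rintro (h | h) <;> contradiction)
      · exact ⟨u, hu, h⟩
      · exact absurd (((hr u hu z).1 h) ▸ hrA u hu) hz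
  · have hB : ∀ u : (A ∪ B : Set V), u.1 ∉ A → u.1 ∈ B := fun u h => u.2.resolve_left h
    refine connected_transfer hAB.2
      (fun u => if h : u.1 ∈ A then (⟨u.1, h⟩ : A) else ⟨r u.1, hrA _ (hB u h)⟩) ?_ ?_
    · intro u v huv
      have huv' : G.Adj u.1 v.1 := by simpa using huv
      by_cases hu : u.1 ∈ A <;> by_cases hv : v.1 ∈ A
      · simp only [hu, hv, dif_pos]
        exact Adj.reachable (by simpa using huv')
      · have := (hr v.1 (hB v hv) u.1).1 huv'.symm
        simp only [hu, hv, dif_pos, dif_neg, not_false_eq_true, ← this]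
        exact Reachable.refl _
      · have := (hr u.1 (hB u hu) v.1).1 huv'
        simp only [hu, hv, dif_pos, dif_neg, not_false_eq_true, ← this]
        exact Reachable.refl _
      · have := (hr u.1 (hB u hu) v.1).1 huv'
        exact absurd (this ▸ hrA u.1 (hB u hu)) hv
    · rintro ⟨x, hx⟩
      refine ⟨⟨x, Or.inl hx⟩, ?_⟩
      simp only [hx, dif_pos]
      exact Reachable.refl _

lemma cut_mem {G : SimpleGraph V} {S : Set V} (hS : IsCDS G S) {v : V}
    (hv : ¬ (G.induce {w | w ≠ v}).Connected) : v ∈ S := by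
  by_contra h
  refine hv (cds_mono hS ?_).2
  rintro z hz rfl
  exact h hz

lemma part_eq {Φ : Set (Set V)} (hΦ : Setoid.IsPartition Φ) {A B : Set V}
    (hA : A ∈ Φ) (hB : B ∈ Φ) {z : V} (h1 : z ∈ A) (h2 : z ∈ B) : A = B := by
  by_contra h
  exact Set.disjoint_left.1 (hΦ.pairwiseDisjoint hA hB h) h1 h2

lemma case_cut [Fintype V] (G : SimpleGraph V)
    (hconn : G.Connected) (hn : 5 ≤ Fintype.card V)
    (huni : G.edgeSet.ncard = Fintype.card V) (Φ : Set (Set V))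
    (hΦ : Setoid.IsPartition Φ)
    (hco : ∀ A ∈ Φ, ∃ B ∈ Φ, B ≠ A ∧ IsConnCoalition G A B)
    (v : V) (hv : ¬ (G.induce {w | w ≠ v}).Connected) : Φ.ncard ≤ 3 := by
  classical
  by_contra hcard
  push Not at hcard
  obtain ⟨A, ⟨hA, hvA⟩, -⟩ := hΦ.2 v
  have hpart : ∀ B ∈ Φ, B ≠ A → IsCDS G (A ∪ B) ∧ ¬ IsCDS G A := by
    intro B hB hBA
    obtain ⟨X, hX, hXB, -, nB, nX, hU⟩ := hco B hB
    have hXA : X = A := by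
      rcases cut_mem hU hv with h | h
      · exact absurd (part_eq hΦ hB hA h hvA) hBA
      · exact part_eq hΦ hX hA h hvA
    subst hXA
    exact ⟨by rwa [Set.union_comm], nX⟩
  have h3 : 2 < (Φ \ {A}).ncard := by
    have := Set.ncard_sdiff_singleton_add_one hA (Set.toFinite _)
    omega
  obtain ⟨B1, B2, B3, ⟨hB1, n1⟩, ⟨hB2, n2⟩, ⟨hB3, n3⟩, h12, h13, h23⟩ :=
    (Set.two_lt_ncard_iff (Set.toFinite _)).1 h3
  simp only [Set.mem_singleton_iff] at n1 n2 n3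
  have key : ∀ B ∈ Φ, ∀ C ∈ Φ, ∀ D ∈ Φ, B ≠ A → C ≠ A → D ≠ A → B ≠ C → B ≠ D → C ≠ D →
      ∃ y ∈ B, 2 ≤ (G.neighborSet y).ncard := by
    intro B hB C hC D hD nB nC nD hBC hBD hCD
    by_contra hno
    push Not at hno
    refine (hpart B hB nB).2 (remove_leaves G A B (hpart B hB nB).1
      (hΦ.pairwiseDisjoint hA hB nB.symm) ?_)
    intro u hu
    have uniq : ∀ w z, G.Adj u w → G.Adj u z → z = w := by
      intro w z hw hz
      have h1 : (G.neighborSet u).ncard ≤ 1 := by have := hno u hu; omega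
      exact (Set.ncard_le_one (Set.toFinite _)).1 h1 z hz w hw
    have huA : u ∉ A := fun h => nB (part_eq hΦ hB hA hu h)
    obtain ⟨w, hw, hwu⟩ := (hpart C hC nC).1.1 u (by
      rintro (h | h)
      · exact huA h
      · exact hBC (part_eq hΦ hB hC hu h))
    obtain ⟨w', hw', hwu'⟩ := (hpart D hD nD).1.1 u (by
      rintro (h | h)
      · exact huA h
      · exact hBD (part_eq hΦ hB hD hu h))
    have e := uniq w w' hwu.symm hwu'.symm
    subst e
    refine ⟨w', ?_, fun z => ⟨fun h => uniq _ _ hwu.symm h, fun h => h ▸ hwu.symm⟩⟩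
    rcases hw with h | h
    · exact h
    · rcases hw' with h' | h'
      · exact h'
      · exact absurd (part_eq hΦ hC hD h h') hCD
  obtain ⟨y1, hy1, d1⟩ := key B1 hB1 B2 hB2 B3 hB3 n1 n2 n3 h12 h13 h23
  obtain ⟨y2, hy2, d2⟩ := key B2 hB2 B1 hB1 B3 hB3 n2 n1 n3 h12.symm h23 h13
  obtain ⟨y3, hy3, d3⟩ := key B3 hB3 B1 hB1 B2 hB2 n3 n1 n2 h13.symm h23.symm h12
  have nm : ∀ B ∈ Φ, ∀ C ∈ Φ, B ≠ A → B ≠ C → ∀ y ∈ B, y ∉ A ∪ C := by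
    rintro B hB C hC nB nBC y hy (h | h)
    · exact nB (part_eq hΦ hB hA hy h)
    · exact nBC (part_eq hΦ hB hC hy h)
  refine no_triple G hconn hn huni y1 y2 y3 ?_ ?_ ?_ d1 d2 d3
    ⟨A ∪ B3, (hpart B3 hB3 n3).1, nm B1 hB1 B3 hB3 n1 h13 y1 hy1, nm B2 hB2 B3 hB3 n2 h23 y2 hy2⟩
    ⟨A ∪ B2, (hpart B2 hB2 n2).1, nm B1 hB1 B2 hB2 n1 h12 y1 hy1,
      nm B3 hB3 B2 hB2 n3 h23.symm y3 hy3⟩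
    ⟨A ∪ B1, (hpart B1 hB1 n1).1, nm B2 hB2 B1 hB1 n2 h12.symm y2 hy2,
      nm B3 hB3 B1 hB1 n3 h13.symm y3 hy3⟩
  · rintro rfl; exact h12 (part_eq hΦ hB1 hB2 hy1 hy2)
  · rintro rfl; exact h13 (part_eq hΦ hB1 hB3 hy1 hy3)
  · rintro rfl; exact h23 (part_eq hΦ hB2 hB3 hy2 hy3)

lemma not_four [Fintype V] (hn : 5 ≤ Fintype.card V) (p q r s : V)
    (h : ∀ z, z = p ∨ z = q ∨ z = r ∨ z = s) : False := by
  classical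
  have hcard : Fintype.card V ≤ ({p, q, r, s} : Finset V).card := by
    rw [← Finset.card_univ]
    apply Finset.card_le_card
    intro z _
    simpa using h z
  have := Finset.card_le_four (a := p) (b := q) (c := r) (d := s)
  omega

lemma case_nocut [Fintype V] (G : SimpleGraph V)
    (hconn : G.Connected) (hn : 5 ≤ Fintype.card V)
    (huni : G.edgeSet.ncard = Fintype.card V) (Φ : Set (Set V))
    (hΦ : Setoid.IsPartition Φ)
    (hco : ∀ A ∈ Φ, ∃ B ∈ Φ, B ≠ A ∧ IsConnCoalition G A B)
    (hv : ∀ v, (G.induce {w | w ≠ v}).Connected) : Φ.ncard ≤ 3 := by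
  classical
  have hdeg : ∀ v, 2 ≤ (G.neighborSet v).ncard := by
    have e : ∀ v, (G.neighborSet v).ncard = G.degree v := by
      intro v
      rw [← G.card_neighborSet_eq_degree, ← Nat.card_eq_fintype_card]; rfl
    have hsum := G.sum_degrees_eq_twice_card_edges
    have he : G.edgeFinset.card = Fintype.card V := by
      rw [← huni, ← G.coe_edgeFinset, Set.ncard_coe_finset]
    by_contra hno
    push Not at hno
    obtain ⟨u, hu⟩ := hno
    have : ∑ v, G.degree v < ∑ v : V, 2 := by
      apply Finset.sum_lt_sum
      · intro v _
        rw [← e]; exact deg_le_two G huni v (hv v)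
      · exact ⟨u, Finset.mem_univ _, by rw [← e]; exact hu⟩
    simp at this
    omega
  have tri : ∀ p q r : V, p ≠ q → p ≠ r → q ≠ r → (∃ S, IsCDS G S ∧ p ∉ S ∧ q ∉ S) →
      (∃ S, IsCDS G S ∧ p ∉ S ∧ r ∉ S) → (∃ S, IsCDS G S ∧ q ∉ S ∧ r ∉ S) → False :=
    fun p q r a b c => no_triple G hconn hn huni p q r a b c (hdeg p) (hdeg q) (hdeg r)
  have two : ∀ S, IsCDS G S → ∀ p q, p ∉ S → q ∉ S → p ≠ q → ∀ z, z ∈ S ∨ z = p ∨ z = q := by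
    intro S hS p q hp hq hpq z
    by_contra hz
    push Not at hz
    exact tri p q z hpq hz.2.1.symm hz.2.2.symm ⟨S, hS, hp, hq⟩ ⟨S, hS, hp, hz.1⟩
      ⟨S, hS, hq, hz.1⟩
  by_contra hcard
  push Not at hcard
  have hne : Φ.Nonempty := Set.nonempty_of_ncard_ne_zero (by omega)
  obtain ⟨A, hA⟩ := hne
  obtain ⟨B, hB, hBA, -, -, -, hAB⟩ := hco A hA
  have h2 : 1 < (Φ \ {A, B}).ncard := by
    have := Set.le_ncard_sdiff {A, B} Φ (Set.toFinite _)
    have := Set.ncard_pair hBA.symm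
    omega
  obtain ⟨C, D, ⟨hC, nC⟩, ⟨hD, nD⟩, hCD⟩ := (Set.one_lt_ncard_iff (Set.toFinite _)).1 h2
  simp only [Set.mem_insert_iff, Set.mem_singleton_iff, not_or] at nC nD
  have nonem : ∀ X ∈ Φ, ∃ x, x ∈ X := fun X hX => Setoid.nonempty_of_mem_partition hΦ hX
  obtain ⟨a, ha⟩ := nonem A hA
  obtain ⟨b, hb⟩ := nonem B hB
  obtain ⟨c, hc⟩ := nonem C hC
  obtain ⟨d, hd⟩ := nonem D hD
  have dj : ∀ X ∈ Φ, ∀ Y ∈ Φ, X ≠ Y → ∀ z ∈ X, z ∉ Y :=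
    fun X hX Y hY h z h1 h2 => h (part_eq hΦ hX hY h1 h2)
  have dAB := dj A hA B hB hBA.symm
  have dAC := dj A hA C hC (Ne.symm nC.1)
  have dAD := dj A hA D hD (Ne.symm nD.1)
  have dBC := dj B hB C hC (Ne.symm nC.2)
  have dBD := dj B hB D hD (Ne.symm nD.2)
  have dCD := dj C hC D hD hCD
  have ncd : c ≠ d := fun h => dCD c hc (h ▸ hd)
  have nab : a ≠ b := fun h => dAB a ha (h ▸ hb)
  have nac : a ≠ c := fun h => dAC a ha (h ▸ hc)
  have nad : a ≠ d := fun h => dAD a ha (h ▸ hd)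
  have nbc : b ≠ c := fun h => dBC b hb (h ▸ hc)
  have nbd : b ≠ d := fun h => dBD b hb (h ▸ hd)
  have cov := two _ hAB c d (by grind) (by grind) ncd
  have four : ∀ X ∈ Φ, X = A ∨ X = B ∨ X = C ∨ X = D := by
    intro X hX
    obtain ⟨x, hx⟩ := nonem X hX
    rcases cov x with (h | h) | h | h
    · exact Or.inl (part_eq hΦ hX hA hx h)
    · exact Or.inr (Or.inl (part_eq hΦ hX hB hx h))
    · exact Or.inr (Or.inr (Or.inl (part_eq hΦ hX hC hx (h ▸ hc))))
    · exact Or.inr (Or.inr (Or.inr (part_eq hΦ hX hD hx (h ▸ hd))))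
  have hCD' : ¬ IsCDS G (C ∪ D) := by
    intro h
    have cov2 := two _ h a b (by grind) (by grind) nab
    exact not_four hn a b c d (fun z => by
        have k1 := cov z
        have k2 := cov2 z
        have k5 := dAB z
        have k6 := dAC z
        have k7 := dAD z
        have k8 := dBC z
        have k9 := dBD z
        have k10 := dCD z
        clear * - k1 k2 k5 k6 k7 k8 k9 k10
        grind)
  obtain ⟨X, hX, hXC, -, -, -, hCX⟩ := hco C hC
  obtain ⟨W, hW, hWD, -, -, -, hDW⟩ := hco D hD
  rcases four X hX with rfl | rfl | rfl | rfl
  · have cov2 := two _ hCX b d (by grind) (by grind) nbd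
    rcases four W hW with rfl | rfl | rfl | rfl
    · exact tri b c d nbc nbd ncd ⟨_, hDW, by grind, by grind⟩ ⟨_, hCX, by grind, by grind⟩
        ⟨_, hAB, by grind, by grind⟩
    · have cov3 := two _ hDW a c (by grind) (by grind) nac
      exact not_four hn a b c d (fun z => by
        have k1 := cov z
        have k2 := cov2 z
        have k3 := cov3 z
        have k5 := dAB z
        have k6 := dAC z
        have k7 := dAD z
        have k8 := dBC z
        have k9 := dBD z
        have k10 := dCD z
        clear * - k1 k2 k3 k5 k6 k7 k8 k9 k10
        grind)
    · exact hCD' (by rwa [Set.union_comm])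
    · exact hWD rfl
  · have cov2 := two _ hCX a d (by grind) (by grind) nad
    rcases four W hW with rfl | rfl | rfl | rfl
    · have cov3 := two _ hDW b c (by grind) (by grind) nbc
      exact not_four hn a b c d (fun z => by
        have k1 := cov z
        have k2 := cov2 z
        have k3 := cov3 z
        have k5 := dAB z
        have k6 := dAC z
        have k7 := dAD z
        have k8 := dBC z
        have k9 := dBD z
        have k10 := dCD z
        clear * - k1 k2 k3 k5 k6 k7 k8 k9 k10
        grind)
    · exact tri a c d nac nad ncd ⟨_, hDW, by grind, by grind⟩ ⟨_, hCX, by grind, by grind⟩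
        ⟨_, hAB, by grind, by grind⟩
    · exact hCD' (by rwa [Set.union_comm])
    · exact hWD rfl
  · exact hXC rfl
  · exact hCD' hCX

lemma cycle_deg [Fintype V] (G : SimpleGraph V) {a : V} (c : G.Walk a a) (hc : c.IsCycle)
    {x : V} (hx : x ∈ c.support) : 2 ≤ (G.neighborSet x).ncard := by
  rw [← hc.ncard_neighborSet_toSubgraph_eq_two hx]
  exact Set.ncard_le_ncard (c.toSubgraph.neighborSet_subset x) (Set.toFinite _)

lemma exists_three [Fintype V] (G : SimpleGraph V)
    (hn : 5 ≤ Fintype.card V)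
    (huni : G.edgeSet.ncard = Fintype.card V)
    (hfull : ∀ v, ¬ IsFullVertex G v) (x y : V) (hxy : x ≠ y) (hadj : ¬ G.Adj x y)
    (hx : 2 ≤ (G.neighborSet x).ncard) (hy : 2 ≤ (G.neighborSet y).ncard)
    (cx : (G.induce {w | w ≠ x}).Connected) (cy : (G.induce {w | w ≠ y}).Connected) :
    ∃ Φ : Set (Set V), IsCCPartition G Φ ∧ Φ.ncard = 3 := by
  classical
  have sing : ∀ v, ¬ IsCDS G {v} := by
    intro v h
    refine hfull v (fun w hw => ?_)
    obtain ⟨u, hu, h⟩ := h.1 w (by simpa using hw)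
    rw [Set.mem_singleton_iff] at hu
    exact hu ▸ h
  have rest : ¬ IsCDS G ({x, y}ᶜ : Set V) :=
    fun h => not_conn_pair G huni x y hxy hadj hx hy h.2
  have big : ∀ v, 2 ≤ (G.neighborSet v).ncard → (G.induce {w | w ≠ v}).Connected →
      IsCDS G {w | w ≠ v} := by
    intro v hd hc
    refine ⟨?_, hc⟩
    intro z hz
    have hz : z = v := by simpa using hz
    subst hz
    obtain ⟨u, hu⟩ := Set.nonempty_of_ncard_ne_zero (s := G.neighborSet z) (by omega)
    exact ⟨u, (G.ne_of_adj hu).symm, G.adj_symm hu⟩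
  have e1 : ({x} : Set V) ∪ {x, y}ᶜ = {w | w ≠ y} := by
    ext z; simp only [Set.mem_union, Set.mem_compl_iff, Set.mem_insert_iff,
      Set.mem_singleton_iff, Set.mem_ofPred_eq]; grind
  have e2 : ({y} : Set V) ∪ {x, y}ᶜ = {w | w ≠ x} := by
    ext z; simp only [Set.mem_union, Set.mem_compl_iff, Set.mem_insert_iff,
      Set.mem_singleton_iff, Set.mem_ofPred_eq]; grind
  have c1 : IsConnCoalition G {x} ({x, y}ᶜ) :=
    ⟨by simp, sing x, rest, by rw [e1]; exact big y hy cy⟩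
  have c2 : IsConnCoalition G {y} ({x, y}ᶜ) :=
    ⟨by simp, sing y, rest, by rw [e2]; exact big x hx cx⟩
  have nR : ({x, y}ᶜ : Set V).Nonempty := by
    by_contra h
    rw [Set.not_nonempty_iff_eq_empty, Set.compl_empty_iff] at h
    exact not_four hn x y x y (fun z => by
      have : z ∈ ({x, y} : Set V) := by rw [h]; trivial
      have : z = x ∨ z = y := by simpa using this
      tauto)
  have n1 : ({x} : Set V) ≠ {y} := by simpa using hxy
  have n2 : ({x} : Set V) ≠ {x, y}ᶜ := by
    intro h
    have : x ∈ ({x, y}ᶜ : Set V) := h ▸ rfl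
    simp at this
  have n3 : ({y} : Set V) ≠ {x, y}ᶜ := by
    intro h
    have : y ∈ ({x, y}ᶜ : Set V) := h ▸ rfl
    simp at this
  refine ⟨{{x}, {y}, {x, y}ᶜ}, ⟨⟨?_, ?_⟩, ?_⟩, ?_⟩
  · rintro (h | h | h)
    · exact (Set.singleton_ne_empty x) h.symm
    · exact (Set.singleton_ne_empty y) h.symm
    · exact nR.ne_empty (Set.mem_singleton_iff.1 h).symm
  · intro z
    by_cases hzx : z = x
    · subst hzx
      refine ⟨{z}, by simp, ?_⟩
      rintro B ⟨rfl | rfl | rfl, hB⟩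
      · rfl
      · exact absurd hB hxy
      · simp at hB
    · by_cases hzy : z = y
      · subst hzy
        refine ⟨{z}, by simp, ?_⟩
        rintro B ⟨rfl | rfl | rfl, hB⟩
        · exact absurd hB hzx
        · rfl
        · simp at hB
      · refine ⟨{x, y}ᶜ, by simp [hzx, hzy], ?_⟩
        rintro B ⟨rfl | rfl | rfl, hB⟩
        · exact absurd hB hzx
        · exact absurd hB hzy
        · rfl
  · rintro B (rfl | rfl | rfl)
    · exact Or.inr ⟨{x, y}ᶜ, by simp, n2.symm, c1⟩
    · exact Or.inr ⟨{x, y}ᶜ, by simp, n3.symm, c2⟩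
    · exact Or.inr ⟨{x}, by simp, n2, c1.1.symm, c1.2.2.1, c1.2.1, by
        rw [Set.union_comm]; exact c1.2.2.2⟩
  · rw [Set.ncard_eq_three]
    exact ⟨_, _, _, n1, n2, n3, rfl⟩

end CCU

/-- Let `G` be a unicyclic graph of order `n ≥ 5` with no full vertex,
with unique cycle `c`, and `Y = {v ∈ V(c) : G - v is connected}`. If `Y` contains two
non-adjacent vertices, then `CC(G) = 3`. -/
theorem cc_unicyclic_eq_three {V : Type*} [Fintype V] (G : SimpleGraph V)
    (hconn : G.Connected) (hn : 5 ≤ Fintype.card V)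
    (huni : G.edgeSet.ncard = Fintype.card V)
    (hfull : ∀ v, ¬ IsFullVertex G v)
    {a : V} (c : G.Walk a a) (hc : c.IsCycle)
    (Y : Set V) (hY : Y = {v | v ∈ c.support ∧ (G.induce {w | w ≠ v}).Connected})
    (h : ∃ x ∈ Y, ∃ y ∈ Y, x ≠ y ∧ ¬ G.Adj x y) :
    CC G = 3 := by
  subst hY
  obtain ⟨x, ⟨hxc, hx⟩, y, ⟨hyc, hy⟩, hxy, hadj⟩ := h
  refine IsGreatest.csSup_eq ⟨?_, ?_⟩
  · exact CCU.exists_three G hn huni hfull x y hxy hadj (CCU.cycle_deg G c hc hxc)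
      (CCU.cycle_deg G c hc hyc) hx hy
  · rintro n ⟨Φ, ⟨hΦ, hco⟩, rfl⟩
    have hco' : ∀ A ∈ Φ, ∃ B ∈ Φ, B ≠ A ∧ IsConnCoalition G A B := by
      intro A hA
      rcases hco A hA with ⟨v, _, hv⟩ | h
      · exact absurd hv (hfull v)
      · exact h
    by_cases hv : ∀ v, (G.induce {w | w ≠ v}).Connected
    · exact CCU.case_nocut G hconn hn huni Φ hΦ hco' hv
    · push Not at hv
      obtain ⟨v, hv⟩ := hv
      exact CCU.case_cut G hconn hn huni Φ hΦ hco' v hv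
end

section
/- Let G be a finite connected simple graph with no full vertex and with CC(G) ≥ 3, and let Φ be a connected coalition partition of G of maximum cardinality CC(G). Then any two distinct cut vertices v and w of G belong to the same set of Φ. -/
open SimpleGraph

/-- Every connected dominating set contains every cut vertex. -/
lemma IsCDS.mem_of_isCutVertex {V : Type*} {G : SimpleGraph V} {S : Set V} {v : V}
    (hS : IsCDS G S) (hv : IsCutVertex G v) : v ∈ S := by
  by_contra hvS
  apply hv
  have hsub : S ≤ {w | w ≠ v} := by
    intro x hx hxv
    exact hvS (hxv ▸ hx)
  obtain ⟨hd, hc⟩ := hS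
  obtain ⟨s0⟩ := hc.nonempty
  have key : ∀ x : {w | w ≠ v}, (G.induce {w | w ≠ v}).Reachable x ⟨s0.1, hsub s0.2⟩ := by
    have hin : ∀ s (hs : s ∈ S), (G.induce {w | w ≠ v}).Reachable ⟨s, hsub hs⟩
        ⟨s0.1, hsub s0.2⟩ := by
      intro s hs
      exact (hc.preconnected ⟨s, hs⟩ s0).map (G.induceHomOfLE hsub).toHom
    rintro ⟨x, hx⟩
    by_cases hxS : x ∈ S
    · exact hin x hxS
    · obtain ⟨u, hu, hux⟩ := hd x hxS
      have hadj : (G.induce {w | w ≠ v}).Adj ⟨x, hx⟩ ⟨u, hsub hu⟩ := hux.symm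
      exact hadj.reachable.trans (hin u hu)
  have : Nonempty {w | w ≠ v} := ⟨⟨s0.1, hsub s0.2⟩⟩
  exact ⟨fun x y => (key x).trans (key y).symm⟩

/-- If `G` is connected with no full vertex and `CC(G) ≥ 3`, then in any
maximum connected coalition partition, all cut vertices lie in a common block. -/
theorem cut_vertices_same_block {V : Type*} [Fintype V] (G : SimpleGraph V)
    (hconn : G.Connected) (hfull : ∀ v, ¬ IsFullVertex G v) (h3 : 3 ≤ CC G)
    (Φ : Set (Set V)) (hΦ : IsCCPartition G Φ) (hmax : Φ.ncard = CC G)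
    (v w : V) (hv : IsCutVertex G v) (hw : IsCutVertex G w) (hvw : v ≠ w) :
    ∃ A ∈ Φ, v ∈ A ∧ w ∈ A := by
  obtain ⟨hpart, hco⟩ := hΦ
  obtain ⟨A, ⟨hA, hvA⟩, hAu⟩ := hpart.2 v
  obtain ⟨B, ⟨hB, hwB⟩, hBu⟩ := hpart.2 w
  by_cases hAB : A = B
  · exact ⟨A, hA, hvA, hAB ▸ hwB⟩
  exfalso
  obtain ⟨C, hC, hCn⟩ : ∃ C ∈ Φ, C ∉ ({A, B} : Set (Set V)) := by
    refine Set.exists_mem_notMem_of_ncard_lt_ncard ?_ (Set.toFinite _)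
    rw [Set.ncard_pair hAB]
    omega
  simp only [Set.mem_insert_iff, Set.mem_singleton_iff, not_or] at hCn
  rcases hco C hC with ⟨x, -, hx⟩ | ⟨D, hD, -, -, -, -, hcds⟩
  · exact hfull x hx
  · have h1 : v ∈ D := (hcds.mem_of_isCutVertex hv).resolve_left
      fun h => hCn.1 (hAu C ⟨hC, h⟩)
    have h2 : w ∈ D := (hcds.mem_of_isCutVertex hw).resolve_left
      fun h => hCn.2 (hBu C ⟨hC, h⟩)
    exact hAB ((hAu D ⟨hD, h1⟩).symm.trans (hBu D ⟨hD, h2⟩))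
end

section
/- Let G be a finite connected simple graph with no full vertex, and let A ⊆ V(G) with |A| ≥ 2 be a connected dominating set of G. Then there exists a partition Φ = {A₁, A₂, …, A_k} of A such that for every A_i ∈ Φ there exists A_j ∈ Φ with i ≠ j such that A_i and A_j form a connected coalition of G. -/
open SimpleGraph

theorem coal_symm {V : Type*} {G : SimpleGraph V} {X Y : Set V}
    (h : IsConnCoalition G X Y) : IsConnCoalition G Y X :=
  ⟨h.1.symm, h.2.2.1, h.2.1, Set.union_comm X Y ▸ h.2.2.2⟩

theorem not_cds_empty {V : Type*} {G : SimpleGraph V} : ¬ IsCDS G ∅ := by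
  intro h
  obtain ⟨⟨x, hx⟩⟩ := h.2.nonempty
  exact hx

theorem not_cds_singleton {V : Type*} {G : SimpleGraph V}
    (hfull : ∀ v, ¬ IsFullVertex G v) (v : V) : ¬ IsCDS G {v} := by
  intro h
  apply hfull v
  intro w hw
  obtain ⟨u, hu, huw⟩ := h.1 w hw
  rw [Set.mem_singleton_iff] at hu
  exact hu ▸ huw

theorem cds_aux {V : Type*} [Fintype V] (G : SimpleGraph V)
    (hfull : ∀ v, ¬ IsFullVertex G v) (n : ℕ) :
    ∀ A : Set V, A.ncard = n → IsCDS G A →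
    ∃ Φ : Set (Set V), ∅ ∉ Φ ∧ Φ.PairwiseDisjoint id ∧ ⋃₀ Φ = A ∧
      ∀ Ai ∈ Φ, ∃ Aj ∈ Φ, Aj ≠ Ai ∧ IsConnCoalition G Ai Aj := by
  induction n using Nat.strong_induction_on with
  | _ n ih =>
  intro A hn hA
  obtain ⟨B, hBA, hB⟩ := (Set.toFinite {S : Set V | IsCDS G S}).exists_le_minimal hA
  have hBc : IsCDS G B := hB.prop
  have hBA : B ⊆ A := hBA
  obtain ⟨⟨b, hb⟩⟩ := hBc.2.nonempty
  have h1 : ¬ IsCDS G {b} := not_cds_singleton hfull b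
  have h2 : ¬ IsCDS G (B \ {b}) := by
    intro h
    have : B ⊆ B \ {b} := hB.le_of_le h Set.diff_subset
    exact (this hb).2 rfl
  have hu : ({b} : Set V) ∪ (B \ {b}) = B := by
    rw [Set.union_diff_self]
    exact Set.union_eq_self_of_subset_left (Set.singleton_subset_iff.2 hb)
  have hd : Disjoint ({b} : Set V) (B \ {b}) := Set.disjoint_sdiff_right
  generalize ({b} : Set V) = X at *
  generalize B \ X = Y at *
  subst hu
  have hX : X ≠ ∅ := by rintro rfl; simp at hBc; exact h2 hBc
  have hY : Y ≠ ∅ := by rintro rfl; simp at hBc; exact h1 hBc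
  have hXY : IsConnCoalition G X Y := ⟨hd, h1, h2, hBc⟩
  have hne : ∀ {P Q : Set V}, P ≠ ∅ → Disjoint P Q → P ≠ Q := by
    rintro P Q hP hPQ rfl
    exact hP (disjoint_self.1 hPQ)
  obtain ⟨C, hCd, rfl⟩ : ∃ C, Disjoint (X ∪ Y) C ∧ A = X ∪ Y ∪ C :=
    ⟨A \ (X ∪ Y), Set.disjoint_sdiff_right, (Set.union_diff_cancel hBA).symm⟩
  obtain ⟨hXC, hYC⟩ := Set.disjoint_union_left.1 hCd
  by_cases hC : IsCDS G C
  · have hlt : C.ncard < n := by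
      rw [← hn]
      refine Set.ncard_lt_ncard ⟨Set.subset_union_right, fun h => ?_⟩ (Set.toFinite _)
      obtain ⟨x, hx⟩ := Set.nonempty_iff_ne_empty.2 hX
      exact Set.disjoint_left.1 hXC hx (h (Or.inl (Or.inl hx)))
    obtain ⟨Φ, he, hdis, hun, hco⟩ := ih _ hlt C rfl hC
    have hsub : ∀ S ∈ Φ, S ⊆ C := fun S hS => hun ▸ Set.subset_sUnion_of_mem hS
    refine ⟨insert X (insert Y Φ), ?_, ?_, ?_, ?_⟩
    · simp [he, hX.symm, hY.symm]
    · rw [Set.pairwiseDisjoint_insert, Set.pairwiseDisjoint_insert]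
      refine ⟨⟨hdis, fun S hS _ => hYC.mono_right (hsub S hS)⟩, ?_⟩
      rintro S (rfl | hS) _
      · exact hd
      · exact hXC.mono_right (hsub S hS)
    · rw [Set.sUnion_insert, Set.sUnion_insert, hun, Set.union_assoc]
    · rintro S (rfl | rfl | hS)
      · exact ⟨Y, by simp, (hne hX hd).symm, hXY⟩
      · exact ⟨X, by simp, hne hX hd, coal_symm hXY⟩
      · obtain ⟨T, hT, h⟩ := hco S hS
        exact ⟨T, by simp [hT], h⟩
  · have three : ∀ P Q : Set V, P ≠ ∅ → Q ≠ ∅ → IsConnCoalition G P Q → Disjoint P C →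
        Disjoint Q C → P ∪ Q = X ∪ Y → ¬ IsCDS G P → IsCDS G (P ∪ C) →
        ∃ Φ : Set (Set V), ∅ ∉ Φ ∧ Φ.PairwiseDisjoint id ∧ ⋃₀ Φ = X ∪ Y ∪ C ∧
          ∀ Ai ∈ Φ, ∃ Aj ∈ Φ, Aj ≠ Ai ∧ IsConnCoalition G Ai Aj := by
      intro P Q hP hQ hPQ hPC hQC hPQe hPn hPCc
      have hC0 : C ≠ ∅ := by rintro rfl; simp at hPCc; exact hPn hPCc
      refine ⟨{P, Q, C}, ?_, ?_, ?_, ?_⟩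
      · simp [hP.symm, hQ.symm, hC0.symm]
      · rw [Set.pairwiseDisjoint_insert, Set.pairwiseDisjoint_insert]
        refine ⟨⟨Set.pairwiseDisjoint_singleton _ _, ?_⟩, ?_⟩
        · rintro S rfl _
          exact hQC
        · rintro S (rfl | rfl) _
          · exact hPQ.1
          · exact hPC
      · rw [Set.sUnion_insert, Set.sUnion_insert, Set.sUnion_singleton, ← Set.union_assoc, hPQe]
      · rintro S (rfl | rfl | rfl)
        · exact ⟨Q, by simp, (hne hP hPQ.1).symm, hPQ⟩
        · exact ⟨P, by simp, hne hP hPQ.1, coal_symm hPQ⟩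
        · exact ⟨P, by simp, hne hP hPC, coal_symm ⟨hPC, hPn, hC, hPCc⟩⟩
    by_cases hYCc : IsCDS G (Y ∪ C)
    · exact three Y X hY hX (coal_symm hXY) hYC hXC (Set.union_comm _ _) h2 hYCc
    have hdd : Disjoint X (Y ∪ C) := Set.disjoint_union_right.2 ⟨hd, hXC⟩
    have hco : IsConnCoalition G X (Y ∪ C) := ⟨hdd, h1, hYCc, Set.union_assoc X Y C ▸ hA⟩
    refine ⟨{X, Y ∪ C}, ?_, ?_, ?_, ?_⟩
    · rintro (h | h)
      · exact hX h.symm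
      · exact hY (Set.union_empty_iff.1 (Eq.symm h)).1
    · rw [Set.pairwiseDisjoint_insert]
      refine ⟨Set.pairwiseDisjoint_singleton _ _, ?_⟩
      rintro S rfl _
      exact hdd
    · rw [Set.sUnion_insert, Set.sUnion_singleton, Set.union_assoc]
    · rintro S (rfl | rfl)
      · exact ⟨_, by simp, (hne hX hdd).symm, hco⟩
      · exact ⟨X, by simp, hne hX hdd, coal_symm hco⟩

/-- If `G` is connected with no full vertex and `A` is a connected
dominating set with `|A| ≥ 2`, then `A` can be partitioned so that every block forms a
connected coalition of `G` with some other block. -/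
theorem cds_coalition_partition {V : Type*} [Fintype V] (G : SimpleGraph V)
    (hconn : G.Connected) (hfull : ∀ v, ¬ IsFullVertex G v)
    (A : Set V) (hA : IsCDS G A) (h2 : 2 ≤ A.ncard) :
    ∃ Φ : Set (Set V), ∅ ∉ Φ ∧ Φ.PairwiseDisjoint id ∧ ⋃₀ Φ = A ∧
      ∀ Ai ∈ Φ, ∃ Aj ∈ Φ, Aj ≠ Ai ∧ IsConnCoalition G Ai Aj := by
  exact cds_aux G hfull _ A rfl hA
end

section
/- For the cycle graph C_n on n ≥ 3 vertices: CC(C₄) = 4, and CC(C_n) = 3 for every n ≥ 3 with n ≠ 4. -/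
open SimpleGraph

theorem cyc_val_adj (m : ℕ) (u x y : Fin (m+3)) (h : (cycleGraph (m+3)).Adj x y) :
    (x-u).val + 1 = (y-u).val ∨ (y-u).val + 1 = (x-u).val ∨
    ((x-u).val = 0 ∧ (y-u).val = m+2) ∨ ((y-u).val = 0 ∧ (x-u).val = m+2) := by
  have key : ∀ a b : Fin (m+3), a - b = 1 →
      b.val + 1 = a.val ∨ (a.val = 0 ∧ b.val = m+2) := by
    intro a b hab
    have h1 : a = b + 1 := by rw [← hab]; abel
    subst h1
    have := b.isLt
    by_cases hb : b.val + 1 < m + 3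
    · left
      rw [Fin.val_add]
      simp [Nat.mod_eq_of_lt hb]
    · right
      have : b.val = m+2 := by omega
      rw [Fin.val_add]
      simp [this]
  rw [cycleGraph_adj] at h
  rcases h with h | h
  · have := key (x-u) (y-u) (by rw [← h]; abel)
    tauto
  · have := key (y-u) (x-u) (by rw [← h]; abel)
    tauto

theorem cyc_adj_add (m : ℕ) (x : Fin (m+3)) : (cycleGraph (m+3)).Adj x (x+1) := by
  rw [cycleGraph_adj]; right; abel

theorem cyc_adj_sub (m : ℕ) (x : Fin (m+3)) : (cycleGraph (m+3)).Adj x (x-1) := by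
  rw [cycleGraph_adj]; left; abel

/-- The complement of a CDS is pairwise adjacent. -/
theorem cyc_cds_adj (m : ℕ) (S : Set (Fin (m+3))) (hS : IsCDS (cycleGraph (m+3)) S)
    (u v : Fin (m+3)) (hu : u ∉ S) (hv : v ∉ S) (huv : u ≠ v) :
    (cycleGraph (m+3)).Adj u v := by
  by_contra hadj
  obtain ⟨hdom, hconn⟩ := hS
  -- inside
  have hd0 : (v-u).val ≠ 0 := by
    intro h
    have : v - u = 0 := Fin.ext h
    exact huv (sub_eq_zero.mp this).symm
  have one_of : ∀ a : Fin (m+3), a.val = 1 → a = 1 := by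
    intro a h; apply Fin.ext; simpa using h
  have hd1 : (v-u).val ≠ 1 := by
    intro h
    apply hadj
    rw [cycleGraph_adj]
    right; exact one_of _ h
  have hdm : (v-u).val ≠ m+2 := by
    intro h
    apply hadj
    have := cyc_val_adj m u v (v+1) (cyc_adj_add m v)
    have h2 := (v+1-u).isLt
    have h3 : (v+1-u).val = 0 ∨ (v+1-u).val = m+1 := by omega
    rcases h3 with h3 | h3
    · have : v + 1 - u = 0 := Fin.ext h3
      rw [cycleGraph_adj]; left
      rw [← sub_eq_zero.mp this]; abel
    · exfalso
      have e : v + 1 - u = (v - u) + 1 := by abel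
      rw [e, Fin.val_add, h] at h3
      simp at h3
  have hlt := (v-u).isLt
  -- an element inside
  have hu0 : (u-u).val = 0 := by simp
  have inside : ∃ s ∈ S, (s-u).val < (v-u).val := by
    have h1 : (u+1-u).val = 1 := by
      have : u + 1 - u = 1 := by abel
      rw [this]; simp
    by_cases hm : u + 1 ∈ S
    · exact ⟨u+1, hm, by omega⟩
    · obtain ⟨w, hw, hwa⟩ := hdom _ hm
      have := cyc_val_adj m u _ _ hwa
      have hwv : (w-u).val ≠ (v-u).val := by
        intro h
        have := sub_left_injective (Fin.ext h)
        subst this; exact hv hw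
      exact ⟨w, hw, by omega⟩
  have outside : ∃ s ∈ S, (v-u).val < (s-u).val := by
    have hne : ∀ w ∈ S, (w-u).val ≠ (v-u).val := by
      intro w hw h
      have := sub_left_injective (Fin.ext h)
      subst this; exact hv hw
    have hne0 : ∀ w ∈ S, (w-u).val ≠ 0 := by
      intro w hw h
      rw [← hu0] at h
      have := sub_left_injective (Fin.ext h)
      subst this; exact hu hw
    have h1 : (u-1-u).val = m+2 := by
      have e := cyc_val_adj m u u (u-1) (cyc_adj_sub m u)
      have : (u-1-u).val ≠ 1 := by
        intro h
        have e1 := one_of _ h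
        have e2 : u - 1 - u = -1 := by abel
        rw [e2] at e1
        have e3 : (1:Fin (m+3)) + 1 = 0 := by nth_rewrite 1 [← e1]; abel
        have := congrArg Fin.val e3
        rw [Fin.val_add] at this
        simp at this
        rw [Nat.mod_eq_of_lt (by omega)] at this
        omega
      omega
    by_cases hm : u - 1 ∈ S
    · exact ⟨u-1, hm, by omega⟩
    · obtain ⟨w, hw, hwa⟩ := hdom _ hm
      have := cyc_val_adj m u _ _ hwa
      have := hne w hw
      have := hne0 w hw
      exact ⟨w, hw, by omega⟩
  obtain ⟨s, hs, hsd⟩ := inside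
  obtain ⟨t, ht, htd⟩ := outside
  have step : ∀ x y : S, ((cycleGraph (m+3)).induce S).Walk x y →
      (x.1-u).val < (v-u).val → (y.1-u).val < (v-u).val := by
    intro x y w
    induction w with
    | nil => exact id
    | @cons a b c hab w ih =>
      intro hx
      apply ih
      have hab' : (cycleGraph (m+3)).Adj a.1 b.1 := hab
      have := cyc_val_adj m u _ _ hab'
      have h1 : (a.1-u).val ≠ 0 := by
        intro h
        rw [← hu0] at h
        have := sub_left_injective (Fin.ext h)
        exact hu (this ▸ a.2)
      have h2 : (b.1-u).val ≠ (v-u).val := by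
        intro h
        have := sub_left_injective (Fin.ext h)
        exact hv (this ▸ b.2)
      omega
  obtain ⟨w⟩ := hconn.preconnected ⟨s, hs⟩ ⟨t, ht⟩
  have := step _ _ w hsd
  simp only at this
  omega

open scoped Fin.CommRing in
theorem cyc_cds_of (m : ℕ) (S : Set (Fin (m+3))) (i : Fin (m+3))
    (h : ∀ v, v ∉ S → v = i ∨ v = i + 1) : IsCDS (cycleGraph (m+3)) S := by
  have hmem : ∀ v, v ≠ i → v ≠ i + 1 → v ∈ S := by
    intro v h1 h2
    by_contra h3
    rcases h v h3 with h | h <;> contradiction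
  have h0 : ∀ k : ℕ, k ≤ m → i + 2 + (k : Fin (m+3)) ∈ S := by
    intro k hk
    have hv : (2 + (k : Fin (m+3))).val = k + 2 := by
      have : (2 + (k : Fin (m+3))) = ((k+2 : ℕ) : Fin (m+3)) := by push_cast; abel
      rw [this, Fin.val_natCast, Nat.mod_eq_of_lt (by omega)]
    apply hmem
    · intro h
      rw [add_assoc, add_eq_left] at h
      rw [h] at hv; simp at hv
    · intro h
      rw [add_assoc, add_right_inj] at h
      rw [h] at hv; simp at hv
  have h2S : i + 2 ∈ S := by simpa using h0 0 (by omega)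
  have hlast : i + 2 + (m : Fin (m+3)) = i - 1 := by
    have : ((m + 3 : ℕ) : Fin (m+3)) = 0 := by simp
    push_cast at this
    rw [eq_sub_iff_add_eq]
    have e : i + 2 + (m : Fin (m+3)) + 1 = i + ((m : Fin (m+3)) + (2 + 1)) := by abel
    have e3 : (2:Fin (m+3)) + 1 = 3 := by
      have : ((2 + 1 : ℕ) : Fin (m+3)) = ((3:ℕ) : Fin (m+3)) := rfl
      push_cast at this; exact this
    rw [e, e3, this, add_zero]
  have hlS : i - 1 ∈ S := by rw [← hlast]; exact h0 m le_rfl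
  have e2 : i + 1 + 1 = i + 2 := by
    rw [add_assoc]; congr 1
  have a2 : (cycleGraph (m+3)).Adj (i+2) (i+1) := by
    rw [← e2]; exact (cyc_adj_add m _).symm
  have a1 : (cycleGraph (m+3)).Adj (i-1) i := (cyc_adj_sub m _).symm
  refine ⟨?_, ?_⟩
  · intro v hv
    rcases h v hv with rfl | rfl
    · exact ⟨_, hlS, a1⟩
    · exact ⟨_, h2S, a2⟩
  · have hr : ∀ k : ℕ, ∀ hk : k ≤ m, ((cycleGraph (m+3)).induce S).Reachable ⟨i+2, h2S⟩
        ⟨i + 2 + (k : Fin (m+3)), h0 k hk⟩ := by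
      intro k
      induction k with
      | zero => intro hk; simp
      | succ k ih =>
        intro hk
        refine (ih (by omega)).trans (SimpleGraph.Adj.reachable ?_)
        change (cycleGraph (m+3)).Adj (i + 2 + (k : Fin (m+3))) (i + 2 + ((k+1 : ℕ) : Fin (m+3)))
        have : i + 2 + ((k+1 : ℕ) : Fin (m+3)) = i + 2 + (k : Fin (m+3)) + 1 := by
          push_cast; abel
        rw [this]; exact cyc_adj_add m _
    have hrl : ((cycleGraph (m+3)).induce S).Reachable ⟨i+2, h2S⟩ ⟨i-1, hlS⟩ := by
      have := hr m le_rfl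
      have e : (⟨i + 2 + (m : Fin (m+3)), h0 m le_rfl⟩ : S) = ⟨i-1, hlS⟩ := Subtype.ext hlast
      rw [e] at this
      exact this
    rw [SimpleGraph.connected_iff_exists_forall_reachable]
    refine ⟨⟨i+2, h2S⟩, ?_⟩
    rintro ⟨x, hx⟩
    by_cases hx1 : x = i + 1
    · subst hx1
      exact SimpleGraph.Adj.reachable a2
    by_cases hx0 : x = i
    · subst hx0
      exact hrl.trans (SimpleGraph.Adj.reachable a1)
    have hval : ∃ k : ℕ, k ≤ m ∧ x = i + 2 + (k : Fin (m+3)) := by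
      have hl := (x - i).isLt
      have hc : (((x-i).val : ℕ) : Fin (m+3)) = x - i := Fin.cast_val_eq_self _
      have g0 : (x-i).val ≠ 0 := by
        intro h
        exact hx0 (sub_eq_zero.mp (Fin.ext h))
      have g1 : (x-i).val ≠ 1 := by
        intro h
        rw [h] at hc
        apply hx1
        rw [eq_comm, sub_eq_iff_eq_add] at hc
        rw [hc]; push_cast; abel
      refine ⟨(x-i).val - 2, by omega, ?_⟩
      obtain ⟨k, hk⟩ : ∃ k, (x-i).val = k + 2 := ⟨(x-i).val - 2, by omega⟩
      rw [hk] at hc ⊢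
      rw [eq_comm, sub_eq_iff_eq_add] at hc
      rw [hc, Nat.add_sub_cancel]; push_cast; abel
    obtain ⟨k, hk, rfl⟩ := hval
    exact hr k hk

theorem cyc_no_tri (m : ℕ) (hm : 1 ≤ m) (p q r : Fin (m+3))
    (h1 : (cycleGraph (m+3)).Adj p q) (h2 : (cycleGraph (m+3)).Adj q r)
    (h3 : (cycleGraph (m+3)).Adj p r) : False := by
  have a1 := cyc_val_adj m p _ _ h1
  have a2 := cyc_val_adj m p _ _ h2
  have a3 := cyc_val_adj m p _ _ h3
  have : (p-p).val = 0 := by simp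
  omega

open scoped Fin.CommRing in
theorem cyc_not_full (m : ℕ) (hm : 1 ≤ m) (v : Fin (m+3)) :
    ¬ IsFullVertex (cycleGraph (m+3)) v := by
  intro h
  have a1 := cyc_adj_add m v
  have a2 := cyc_adj_add m (v+1)
  have hne : v + 1 + 1 ≠ v := by
    intro h
    have b1 := cyc_val_adj m v _ _ a1
    have e : v + 1 + 1 = v + ((2 : ℕ) : Fin (m+3)) := by
      rw [add_assoc]; congr 1
    rw [e, add_eq_left] at h
    have := congrArg Fin.val h
    rw [Fin.val_natCast, Nat.mod_eq_of_lt (by omega)] at this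
    simp at this
  exact cyc_no_tri m hm _ _ _ a1 a2 (h _ hne)

theorem part_ncard_le {n : ℕ} (Φ : Set (Set (Fin n))) (h : Setoid.IsPartition Φ) :
    Φ.ncard ≤ n := by
  have hne : ∀ A ∈ Φ, ∃ x, x ∈ A := by
    intro A hA
    by_contra hc
    push Not at hc
    have : A = ∅ := Set.eq_empty_iff_forall_notMem.mpr hc
    exact h.1 (this ▸ hA)
  classical
  by_cases hn : Nonempty (Fin n)
  · choose! f hf using hne
    have := Set.ncard_le_ncard_of_injOn (s := Φ) (t := (Set.univ : Set (Fin n))) f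
      (fun _ _ => trivial) (by
        intro A hA B hB hAB
        exact (h.2 (f A)).unique ⟨hA, hf A hA⟩ ⟨hB, hAB ▸ hf B hB⟩) (Set.toFinite _)
    simpa using this
  · have : Φ = ∅ := by
      apply Set.eq_empty_iff_forall_notMem.mpr
      intro A hA
      obtain ⟨x, _⟩ := hne A hA
      exact hn ⟨x⟩
    simp [this]

theorem part_singletons (n : ℕ) :
    Setoid.IsPartition (Set.range (fun x : Fin n => ({x} : Set (Fin n)))) ∧
    (Set.range (fun x : Fin n => ({x} : Set (Fin n)))).ncard = n := by
  refine ⟨⟨?_, ?_⟩, ?_⟩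
  · rintro ⟨x, hx⟩
    exact Set.singleton_ne_empty x hx
  · intro a
    refine ⟨{a}, ⟨⟨a, rfl⟩, rfl⟩, ?_⟩
    rintro _ ⟨⟨x, rfl⟩, hx⟩
    have : a = x := hx
    rw [this]
  · rw [← Set.image_univ, Set.ncard_image_of_injective _ Set.singleton_injective]
    simp

set_option maxHeartbeats 4000000 in
theorem cyc_upper_aux (m : ℕ) (hm : 2 ≤ m) (Φ : Set (Set (Fin (m+3))))
    (hΦ : IsCCPartition (cycleGraph (m+3)) Φ) : Φ.ncard ≤ 3 := by
  by_contra hcard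
  obtain ⟨⟨hemp, huniq⟩, hco⟩ := hΦ
  have hne : ∀ A ∈ Φ, ∃ x, x ∈ A := by
    intro A hA
    by_contra hc
    push Not at hc
    have : A = ∅ := Set.eq_empty_iff_forall_notMem.mpr hc
    exact hemp (this ▸ hA)
  have hdisj : ∀ A ∈ Φ, ∀ B ∈ Φ, ∀ x, x ∈ A → x ∈ B → A = B := by
    intro A hA B hB x hxA hxB
    exact (huniq x).unique ⟨hA, hxA⟩ ⟨hB, hxB⟩
  have hcov : ∀ x, ∃ A ∈ Φ, x ∈ A := fun x => by
    obtain ⟨A, hA, _⟩ := huniq x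
    exact ⟨A, hA.1, hA.2⟩
  have hpart : ∀ A ∈ Φ, ∃ B ∈ Φ, B ≠ A ∧ IsCDS (cycleGraph (m+3)) (A ∪ B) := by
    intro A hA
    rcases hco A hA with ⟨v, _, hv⟩ | ⟨B, hB, hBA, hc⟩
    · exact absurd hv (cyc_not_full m (by omega) v)
    · exact ⟨B, hB, hBA, hc.2.2.2⟩
  have hadj : ∀ A B : Set (Fin (m+3)), IsCDS (cycleGraph (m+3)) (A ∪ B) →
      ∀ p q, p ∉ A → p ∉ B → q ∉ A → q ∉ B → p ≠ q → (cycleGraph (m+3)).Adj p q := by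
    intro A B h p q h1 h2 h3 h4 h5
    exact cyc_cds_adj m _ h p q (by simp [h1, h2]) (by simp [h3, h4]) h5
  have htri : ∀ A B : Set (Fin (m+3)), IsCDS (cycleGraph (m+3)) (A ∪ B) →
      ∀ p q r, p ∉ A → p ∉ B → q ∉ A → q ∉ B → r ∉ A → r ∉ B →
        p ≠ q → q ≠ r → p ≠ r → False := by
    intro A B h p q r h1 h2 h3 h4 h5 h6 h7 h8 h9
    exact cyc_no_tri m (by omega) p q r (hadj A B h p q h1 h2 h3 h4 h7)
      (hadj A B h q r h3 h4 h5 h6 h8) (hadj A B h p r h1 h2 h5 h6 h9)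
  -- the core, with a symmetric choice of A and B
  have core : ∀ A ∈ Φ, ∀ B ∈ Φ, ∀ C ∈ Φ, ∀ D ∈ Φ, A ≠ B → C ≠ A → C ≠ B → D ≠ A → D ≠ B →
      C ≠ D → IsCDS (cycleGraph (m+3)) (A ∪ B) → ∀ a ∈ A, ∀ b ∈ B, ∀ c ∈ C, ∀ d ∈ D,
      ∀ e, (e ∈ A ∨ e ∈ B) → e ≠ a → e ≠ b → IsCDS (cycleGraph (m+3)) (C ∪ A) → False := by
    intro A hA B hB C hC D hD hAB hCA hCB hDA hDB hCD h1 a ha b hb c hc d hd e he hea heb h2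
    have nA := hdisj A hA
    have nB := hdisj B hB
    have nC := hdisj C hC
    have nD := hdisj D hD
    have heA : e ∈ A := by
      rcases he with h | h
      · exact h
      · exact (htri _ _ h2 b e d (by grind) (by grind) (by grind) (by grind) (by grind) (by grind)
          (by grind) (by grind) (by grind)).elim
    obtain ⟨E, hE, hED, h3⟩ := hpart D hD
    have nE := hdisj E hE
    obtain ⟨x, hx⟩ := hne E hE
    by_cases hEA : E = A
    · subst hEA
      exact cyc_no_tri m (by omega) b c d
        (hadj _ _ h3 b c (by grind) (by grind) (by grind) (by grind) (by grind))
        (hadj _ _ h1 c d (by grind) (by grind) (by grind) (by grind) (by grind))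
        (hadj _ _ h2 b d (by grind) (by grind) (by grind) (by grind) (by grind))
    by_cases hEB : E = B
    · subst hEB
      exact htri _ _ h3 a e c (by grind) (by grind) (by grind) (by grind) (by grind) (by grind)
          (by grind) (by grind) (by grind)
    by_cases hEC : E = C
    · subst hEC
      exact htri _ _ h3 a b e (by grind) (by grind) (by grind) (by grind) (by grind) (by grind)
          (by grind) (by grind) (by grind)
    exact htri _ _ h1 x c d (by grind) (by grind) (by grind) (by grind) (by grind) (by grind)
          (by grind) (by grind) (by grind)
  have hnΦ : Φ.Nonempty := by
    rw [Set.nonempty_iff_ne_empty]; rintro rfl; simp at hcard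
  obtain ⟨A, hA⟩ := hnΦ
  obtain ⟨B, hB, hBA, h1⟩ := hpart A hA
  have h2c : 1 < (Φ \ {A, B}).ncard := by
    have e1 := Set.le_ncard_sdiff {A, B} Φ (Set.toFinite _)
    have e2 : ({A, B} : Set (Set (Fin (m+3)))).ncard ≤ 2 :=
      (Set.ncard_insert_le A {B}).trans (by simp)
    omega
  obtain ⟨C, D, hC, hD, hCD⟩ := (Set.one_lt_ncard_iff (Set.toFinite _)).mp h2c
  obtain ⟨hC, hC'⟩ := hC
  obtain ⟨hD, hD'⟩ := hD
  simp only [Set.mem_insert_iff, Set.mem_singleton_iff, not_or] at hC' hD'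
  obtain ⟨a, ha⟩ := hne A hA
  obtain ⟨b, hb⟩ := hne B hB
  obtain ⟨c, hc⟩ := hne C hC
  obtain ⟨d, hd⟩ := hne D hD
  have nA := hdisj A hA
  have nB := hdisj B hB
  have nC := hdisj C hC
  have nD := hdisj D hD
  obtain ⟨e, he⟩ : ∃ e, e ∉ ({a, b, c, d} : Finset (Fin (m+3))) := by
    by_contra hc
    push Not at hc
    have h5 := Finset.card_le_card (s := Finset.univ) (t := {a, b, c, d}) (fun x _ => hc x)
    have h6 : ({a, b, c, d} : Finset (Fin (m+3))).card ≤ 4 := Finset.card_le_four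
    rw [Finset.card_univ, Fintype.card_fin] at h5
    omega
  simp only [Finset.mem_insert, Finset.mem_singleton, not_or] at he
  obtain ⟨hea, heb, hec, hed⟩ := he
  have heAB : e ∈ A ∨ e ∈ B := by
    by_contra hn
    push Not at hn
    exact htri _ _ h1 e c d (by grind) (by grind) (by grind) (by grind) (by grind) (by grind)
          (by grind) (by grind) (by grind)
  obtain ⟨E, hE, hEC, h2⟩ := hpart C hC
  have nE := hdisj E hE
  obtain ⟨x, hx⟩ := hne E hE
  by_cases hEA : E = A
  · subst hEA
    exact core E hA B hB C hC D hD hBA.symm hC'.1 hC'.2 hD'.1 hD'.2 hCD h1 a ha b hb c hc d hd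
      e heAB hea heb h2
  by_cases hEB : E = B
  · subst hEB
    exact core E hB A hA C hC D hD hBA hC'.2 hC'.1 hD'.2 hD'.1 hCD (Set.union_comm A E ▸ h1)
      b hb a ha c hc d hd e heAB.symm heb hea h2
  by_cases hED : E = D
  · exact htri _ _ h2 a b e (by grind) (by grind) (by grind) (by grind) (by grind) (by grind)
          (by grind) (by grind) (by grind)
  exact htri _ _ h1 x c d (by grind) (by grind) (by grind) (by grind) (by grind) (by grind)
          (by grind) (by grind) (by grind)

theorem cyc_lower (m : ℕ) (hm : 2 ≤ m) : ∃ Φ : Set (Set (Fin (m+3))),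
    IsCCPartition (cycleGraph (m+3)) Φ ∧ Φ.ncard = 3 := by
  have val0 : (0 : Fin (m+3)).val = 0 := rfl
  have val1 : (1 : Fin (m+3)).val = 1 := rfl
  have val2 : (2 : Fin (m+3)).val = 2 := rfl
  have h02 : (0 : Fin (m+3)) ≠ 2 := by
    intro h; have := congrArg Fin.val h; omega
  have hX1 : (1 : Fin (m+3)) ∈ ({0, 2} : Set (Fin (m+3)))ᶜ := by
    simp only [Set.mem_compl_iff, Set.mem_insert_iff, Set.mem_singleton_iff, Fin.ext_iff]
    omega
  -- no singleton is a CDS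
  have ns : ∀ x : Fin (m+3), ¬ IsCDS (cycleGraph (m+3)) {x} := by
    intro x hx
    have hall : ∀ p q : Fin (m+3), p ≠ x → q ≠ x → p ≠ q → (cycleGraph (m+3)).Adj p q :=
      fun p q h1 h2 h3 => cyc_cds_adj m _ hx p q h1 h2 h3
    obtain ⟨p, hp⟩ : ∃ e, e ∉ ({x} : Finset (Fin (m+3))) := by
      by_contra hc
      push Not at hc
      have h5 := Finset.card_le_card (s := Finset.univ) (t := {x}) (fun x _ => hc x)
      rw [Finset.card_univ, Fintype.card_fin] at h5
      simp at h5
    obtain ⟨q, hq⟩ : ∃ e, e ∉ ({x, p} : Finset (Fin (m+3))) := by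
      by_contra hc
      push Not at hc
      have h5 := Finset.card_le_card (s := Finset.univ) (t := {x, p}) (fun x _ => hc x)
      have h6 : ({x, p} : Finset (Fin (m+3))).card ≤ 2 := Finset.card_le_two
      rw [Finset.card_univ, Fintype.card_fin] at h5
      omega
    obtain ⟨r, hr⟩ : ∃ e, e ∉ ({x, p, q} : Finset (Fin (m+3))) := by
      by_contra hc
      push Not at hc
      have h5 := Finset.card_le_card (s := Finset.univ) (t := {x, p, q}) (fun x _ => hc x)
      have h6 : ({x, p, q} : Finset (Fin (m+3))).card ≤ 3 := Finset.card_le_three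
      rw [Finset.card_univ, Fintype.card_fin] at h5
      omega
    simp only [Finset.mem_insert, Finset.mem_singleton, not_or] at hp hq hr
    exact cyc_no_tri m (by omega) p q r (hall _ _ hp hq.1 (Ne.symm hq.2))
      (hall _ _ hq.1 hr.1 (Ne.symm hr.2.2)) (hall _ _ hp hr.1 (Ne.symm hr.2.1))
  have nX : ¬ IsCDS (cycleGraph (m+3)) ({0, 2} : Set (Fin (m+3)))ᶜ := by
    intro hx
    have := cyc_cds_adj m _ hx 0 2 (by simp) (by simp) h02
    have := cyc_val_adj m 0 _ _ this
    simp only [sub_zero, val0, val2] at this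
    omega
  have c0 : IsCDS (cycleGraph (m+3)) ({0} ∪ ({0, 2} : Set (Fin (m+3)))ᶜ) := by
    apply cyc_cds_of m _ 2
    intro v hv
    simp at hv
    tauto
  have c2 : IsCDS (cycleGraph (m+3)) ({2} ∪ ({0, 2} : Set (Fin (m+3)))ᶜ) := by
    apply cyc_cds_of m _ 0
    intro v hv
    simp at hv
    tauto
  have d0 : Disjoint ({0} : Set (Fin (m+3))) ({0, 2} : Set (Fin (m+3)))ᶜ := by
    simp
  have d2 : Disjoint ({2} : Set (Fin (m+3))) ({0, 2} : Set (Fin (m+3)))ᶜ := by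
    simp
  have n0 : ({0, 2} : Set (Fin (m+3)))ᶜ ≠ {0} := by
    intro h
    have : (0 : Fin (m+3)) ∈ ({0, 2} : Set (Fin (m+3)))ᶜ := by rw [h]; rfl
    simp at this
  have n2 : ({0, 2} : Set (Fin (m+3)))ᶜ ≠ {2} := by
    intro h
    have : (2 : Fin (m+3)) ∈ ({0, 2} : Set (Fin (m+3)))ᶜ := by rw [h]; rfl
    simp at this
  refine ⟨{{0}, {2}, {0, 2}ᶜ}, ⟨⟨?_, ?_⟩, ?_⟩, ?_⟩
  · intro h
    simp only [Set.mem_insert_iff, Set.mem_singleton_iff] at h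
    rcases h with h | h | h
    · exact Set.singleton_ne_empty _ h.symm
    · exact Set.singleton_ne_empty _ h.symm
    · rw [← h] at hX1; exact hX1
  · intro a
    by_cases a0 : a = 0
    · refine ⟨{0}, ⟨by simp, a0⟩, ?_⟩
      rintro B ⟨hB, haB⟩
      simp only [Set.mem_insert_iff, Set.mem_singleton_iff] at hB
      rcases hB with rfl | rfl | rfl
      · rfl
      · exact absurd (a0.symm.trans haB) h02
      · exact absurd haB (by simp [a0])
    by_cases a2 : a = 2
    · refine ⟨{2}, ⟨by simp, a2⟩, ?_⟩
      rintro B ⟨hB, haB⟩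
      simp only [Set.mem_insert_iff, Set.mem_singleton_iff] at hB
      rcases hB with rfl | rfl | rfl
      · exact absurd haB a0
      · rfl
      · exact absurd haB (by simp [a2])
    · refine ⟨{0, 2}ᶜ, ⟨by simp, by simp [a0, a2]⟩, ?_⟩
      rintro B ⟨hB, haB⟩
      simp only [Set.mem_insert_iff, Set.mem_singleton_iff] at hB
      rcases hB with rfl | rfl | rfl
      · exact absurd haB a0
      · exact absurd haB a2
      · rfl
  · intro A hA
    right
    simp only [Set.mem_insert_iff, Set.mem_singleton_iff] at hA
    rcases hA with rfl | rfl | rfl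
    · exact ⟨{0, 2}ᶜ, by simp, n0, d0, ns 0, nX, c0⟩
    · exact ⟨{0, 2}ᶜ, by simp, n2, d2, ns 2, nX, c2⟩
    · exact ⟨{0}, by simp, n0.symm, d0.symm, nX, ns 0, Set.union_comm _ _ ▸ c0⟩
  · rw [Set.ncard_eq_three]
    exact ⟨_, _, _, fun h => h02 (Set.singleton_injective h), n0.symm, n2.symm, rfl⟩

theorem cyc_four : IsCCPartition (cycleGraph 4)
    (Set.range (fun x : Fin 4 => ({x} : Set (Fin 4)))) := by
  refine ⟨(part_singletons 4).1, ?_⟩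
  have ns : ∀ x : Fin 4, ¬ IsCDS (cycleGraph 4) {x} := by
    intro x hx
    have h1 := cyc_cds_adj 1 _ hx (x+1) (x+3)
    clear hx
    revert h1
    rw [cycleGraph_adj]
    simp only [Set.mem_singleton_iff]
    revert x
    decide
  rintro _ ⟨x, rfl⟩
  right
  refine ⟨{x+1}, ⟨x+1, rfl⟩, ?_, ?_, ns _, ns _, ?_⟩
  · intro h
    have := Set.singleton_injective h
    clear h
    revert this; revert x; decide
  · rw [Set.disjoint_singleton]
    revert x; decide
  · apply cyc_cds_of 1 _ (x+2)
    intro v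
    simp only [Set.mem_union, Set.mem_singleton_iff]
    revert x v; decide

theorem cyc_three : IsCCPartition (cycleGraph 3)
    (Set.range (fun x : Fin 3 => ({x} : Set (Fin 3)))) := by
  refine ⟨(part_singletons 3).1, ?_⟩
  rintro _ ⟨x, rfl⟩
  left
  refine ⟨x, rfl, ?_⟩
  intro w
  rw [cycleGraph_adj]
  revert x w; decide

/-- `CC(C₄) = 4`, and `CC(Cₙ) = 3` for every `n ≥ 3` with `n ≠ 4`. -/
theorem cc_cycleGraph :
    CC (SimpleGraph.cycleGraph 4) = 4 ∧
      ∀ n : ℕ, 3 ≤ n → n ≠ 4 → CC (SimpleGraph.cycleGraph n) = 3 := by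
  constructor
  · apply IsGreatest.csSup_eq
    refine ⟨⟨_, cyc_four, (part_singletons 4).2⟩, ?_⟩
    rintro _ ⟨Φ, hΦ, rfl⟩
    exact part_ncard_le Φ hΦ.1
  · intro n hn hn4
    obtain ⟨m, rfl⟩ : ∃ m, n = m + 3 := ⟨n - 3, by omega⟩
    apply IsGreatest.csSup_eq
    by_cases hm : m = 0
    · subst hm
      refine ⟨⟨_, cyc_three, (part_singletons 3).2⟩, ?_⟩
      rintro _ ⟨Φ, hΦ, rfl⟩
      exact part_ncard_le Φ hΦ.1
    · refine ⟨cyc_lower m (by omega), ?_⟩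
      rintro _ ⟨Φ, hΦ, rfl⟩
      exact cyc_upper_aux m (by omega) Φ hΦ
end

section
/- Let G and H be finite connected simple graphs, each with at least two vertices. Then the Cartesian product satisfies CC(G □ H) ≥ max{CC(G) + k_G, CC(H) + k_H}, where k_G and k_H denote the number of full vertices of G and of H, respectively. -/
open SimpleGraph

lemma cc_ge_of_label {V ι : Type*} [Finite V] (G : SimpleGraph V) (f : V → ι)
    (hf : Function.Surjective f)
    (h : ∀ i, (∃ v, f ⁻¹' {i} = {v} ∧ IsFullVertex G v) ∨
      ∃ j, j ≠ i ∧ ¬ IsCDS G (f ⁻¹' {i}) ∧ ¬ IsCDS G (f ⁻¹' {j}) ∧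
        IsCDS G (f ⁻¹' {i} ∪ f ⁻¹' {j})) :
    Nat.card ι ≤ CC G := by
  have hinj : Function.Injective (fun i => f ⁻¹' {i}) := by
    intro i j hij
    obtain ⟨v, rfl⟩ := hf i
    have : v ∈ f ⁻¹' {j} := by
      have h1 : v ∈ f ⁻¹' {f v} := rfl
      exact (show f ⁻¹' {f v} = f ⁻¹' {j} from hij) ▸ h1
    exact this
  have hbdd : BddAbove {n : ℕ | ∃ Φ : Set (Set V), IsCCPartition G Φ ∧ Φ.ncard = n} := by
    refine ⟨Nat.card (Set V), ?_⟩
    rintro n ⟨Φ, -, rfl⟩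
    exact Set.ncard_le_card Φ
  refine le_csSup hbdd ⟨Set.range (fun i => f ⁻¹' {i}), ⟨⟨?_, ?_⟩, ?_⟩, ?_⟩
  · rintro ⟨i, hi⟩
    obtain ⟨v, rfl⟩ := hf i
    have h1 : v ∈ f ⁻¹' {f v} := rfl
    have h2 : f ⁻¹' {f v} = ∅ := hi
    rw [h2] at h1
    exact h1
  · intro a
    refine ⟨f ⁻¹' {f a}, ⟨⟨f a, rfl⟩, rfl⟩, ?_⟩
    rintro _ ⟨⟨i, rfl⟩, hi⟩
    have : f a = i := hi
    subst this
    rfl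
  · rintro _ ⟨i, rfl⟩
    rcases h i with h | ⟨j, hj, h1, h2, h3⟩
    · exact Or.inl h
    · refine Or.inr ⟨f ⁻¹' {j}, ⟨j, rfl⟩, fun e => hj (hinj e), ?_, h1, h2, h3⟩
      rw [Set.disjoint_left]
      intro x hx hx'
      have hx : f x = i := hx
      have hx' : f x = j := hx'
      exact hj (hx'.symm.trans hx)
  · rw [← Set.image_univ, Set.ncard_image_of_injective _ hinj, Set.ncard_univ]

lemma exists_label {V : Type*} (Φ : Set (Set V)) (h : Setoid.IsPartition Φ) :
    ∃ f : V → Φ, Function.Surjective f ∧ ∀ A : Φ, f ⁻¹' {A} = A.1 := by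
  choose f hf hu using h.2
  have key : ∀ A : Φ, ∀ v, v ∈ A.1 ↔ (⟨f v, (hf v).1⟩ : Φ) = A := by
    rintro ⟨A, hA⟩ v
    constructor
    · intro hv
      exact Subtype.ext (hu v A ⟨hA, hv⟩).symm
    · intro e
      have e : f v = A := congrArg Subtype.val e
      subst e
      exact (hf v).2
  refine ⟨fun v => ⟨f v, (hf v).1⟩, ?_, ?_⟩
  · rintro A
    have hne : A.1.Nonempty := by
      rw [Set.nonempty_iff_ne_empty]
      intro e
      exact h.1 (e ▸ A.2)
    obtain ⟨v, hv⟩ := hne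
    exact ⟨v, (key A v).1 hv⟩
  · intro A
    ext v
    exact (key A v).symm

lemma cc_cases {V : Type*} [Finite V] (G : SimpleGraph V) :
    CC G = 0 ∨ ∃ Φ : Set (Set V), IsCCPartition G Φ ∧ Φ.ncard = CC G := by
  rcases Set.eq_empty_or_nonempty
    {n : ℕ | ∃ Φ : Set (Set V), IsCCPartition G Φ ∧ Φ.ncard = n} with h | h
  · left
    unfold CC
    rw [h]
    simp
  · right
    refine Nat.sSup_mem h ⟨Nat.card (Set V), ?_⟩
    rintro n ⟨Φ, -, rfl⟩
    exact Set.ncard_le_card Φ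

/-- A property preserved along adjacency is preserved along reachability. -/
lemma reach_invariant {V : Type*} {G : SimpleGraph V} (p : V → Prop)
    (h : ∀ a b, G.Adj a b → p a → p b) {a b : V} (hr : G.Reachable a b) (ha : p a) : p b := by
  obtain ⟨w⟩ := hr
  induction w with
  | nil => exact ha
  | cons hadj _ ih => exact ih (h _ _ hadj ha)

lemma isCDS_iso {V W : Type*} {G : SimpleGraph V} {H : SimpleGraph W} (e : G ≃g H)
    {S : Set W} (h : IsCDS H S) : IsCDS G (e ⁻¹' S) := by
  obtain ⟨hd, hc⟩ := h
  refine ⟨?_, ?_⟩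
  · intro v hv
    obtain ⟨u, hu, hadj⟩ := hd (e v) hv
    refine ⟨e.symm u, by simpa using hu, ?_⟩
    rw [← e.map_adj_iff]
    simpa using hadj
  · let φ : H.induce S →g G.induce (e ⁻¹' S) :=
      { toFun := fun x => ⟨e.symm x.1, by simp⟩
        map_rel' := by
          intro a b hab
          have hab : H.Adj a.1 b.1 := hab
          change G.Adj (e.symm a.1) (e.symm b.1)
          rw [← e.map_adj_iff]
          simpa using hab }
    refine hc.map φ ?_
    rintro ⟨x, hx⟩
    exact ⟨⟨e x, hx⟩, by simp [φ]⟩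

lemma isCDS_iso_iff {V W : Type*} {G : SimpleGraph V} {H : SimpleGraph W} (e : G ≃g H)
    (S : Set W) : IsCDS G (e ⁻¹' S) ↔ IsCDS H S := by
  refine ⟨fun h => ?_, isCDS_iso e⟩
  have := isCDS_iso e.symm h
  convert this using 1
  ext x
  simp

lemma cc_le_of_iso {V W : Type*} [Finite V] [Finite W] {G : SimpleGraph V} {H : SimpleGraph W}
    (e : G ≃g H) : CC H ≤ CC G := by
  rcases cc_cases H with h | ⟨Φ, hΦ, hn⟩
  · omega
  obtain ⟨f, hf, hfib⟩ := exists_label Φ hΦ.1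
  rw [← hn, ← Nat.card_coe_set_eq]
  have hpre : ∀ i, (f ∘ e) ⁻¹' {i} = e ⁻¹' i.1 := by
    intro i
    rw [Set.preimage_comp, hfib]
  refine cc_ge_of_label G (f ∘ e) (hf.comp e.surjective) ?_
  intro i
  rw [hpre]
  rcases hΦ.2 i.1 i.2 with ⟨v, hv, hfull⟩ | ⟨B, hB, hne, -, h1, h2, h3⟩
  · left
    refine ⟨e.symm v, ?_, ?_⟩
    · rw [hv]
      ext x
      simp only [Set.mem_preimage, Set.mem_singleton_iff]
      constructor
      · rintro rfl
        simp
      · rintro rfl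
        simp
    · intro w hw
      rw [← e.map_adj_iff]
      simp only [RelIso.apply_symm_apply]
      refine hfull _ ?_
      rintro rfl
      simp at hw
  · right
    refine ⟨⟨B, hB⟩, fun h => hne (congrArg Subtype.val h), ?_⟩
    rw [hpre, ← Set.preimage_union]
    simp only [isCDS_iso_iff]
    exact ⟨h1, h2, h3⟩

lemma isCDS_cyl {V W : Type*} {G : SimpleGraph V} {H : SimpleGraph W} (hH : H.Connected)
    {A : Set V} (h : IsCDS G A) : IsCDS (G.boxProd H) (Prod.fst ⁻¹' A) := by
  obtain ⟨hd, hc⟩ := h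
  refine ⟨?_, ?_⟩
  · rintro ⟨v, w⟩ hv
    obtain ⟨u, hu, hadj⟩ := hd v hv
    exact ⟨(u, w), hu, by simp [boxProd_adj, hadj]⟩
  · let φ : (G.induce A).boxProd H →g (G.boxProd H).induce (Prod.fst ⁻¹' A) :=
      { toFun := fun x => ⟨(x.1.1, x.2), x.1.2⟩
        map_rel' := by
          rintro ⟨⟨a, ha⟩, b⟩ ⟨⟨a', ha'⟩, b'⟩ hab
          simpa [boxProd_adj] using hab }
    refine (hc.boxProd hH).map φ ?_
    rintro ⟨⟨x, y⟩, hx⟩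
    exact ⟨(⟨x, hx⟩, y), rfl⟩

lemma isCDS_of_cyl {V W : Type*} {G : SimpleGraph V} {H : SimpleGraph W} [Nonempty W]
    {A : Set V} (h : IsCDS (G.boxProd H) (Prod.fst ⁻¹' A)) : IsCDS G A := by
  obtain ⟨hd, hc⟩ := h
  obtain ⟨w⟩ := ‹Nonempty W›
  refine ⟨?_, ?_⟩
  · intro v hv
    obtain ⟨⟨u, w'⟩, hu, hadj⟩ := hd (v, w) hv
    have hu : u ∈ A := hu
    rw [boxProd_adj] at hadj
    rcases hadj with h | h
    · exact ⟨u, hu, h.1⟩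
    · have : u = v := h.2
      exact absurd (this ▸ hu) hv
  · obtain ⟨⟨x, hx⟩⟩ := hc.nonempty
    have : Nonempty A := ⟨⟨x.1, hx⟩⟩
    refine ⟨?_⟩
    rintro ⟨a, ha⟩ ⟨b, hb⟩
    have hr := hc.preconnected ⟨(a, w), ha⟩ ⟨(b, w), hb⟩
    refine reach_invariant
      (p := fun z : (Prod.fst ⁻¹' A : Set (V × W)) =>
        (G.induce A).Reachable ⟨a, ha⟩ ⟨z.1.1, z.2⟩) ?_ hr (Reachable.refl _)
    rintro ⟨⟨c, y⟩, hc⟩ ⟨⟨d, z⟩, hd⟩ hadj hreach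
    have hadj : (G.boxProd H).Adj (c, y) (d, z) := hadj
    rw [boxProd_adj] at hadj
    rcases hadj with h | h
    · exact hreach.trans (Adj.reachable h.1)
    · have : c = d := h.2
      subst this
      exact hreach

lemma not_isCDS_slice {V W : Type*} {G : SimpleGraph V} {H : SimpleGraph W} {S : Set (V × W)}
    {v v' : V} {w : W} (hv : v' ≠ v) (hS : ∀ x ∈ S, x.1 = v) (hw : (v, w) ∉ S) :
    ¬ IsCDS (G.boxProd H) S := by
  rintro ⟨hd, -⟩
  obtain ⟨⟨a, b⟩, hu, hadj⟩ := hd (v', w) (fun h => hv (hS _ h))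
  have ha : a = v := hS _ hu
  subst ha
  rw [boxProd_adj] at hadj
  rcases hadj with h | h
  · have : b = w := h.2
    exact hw (this ▸ hu)
  · exact hv h.2.symm

lemma isCDS_of_full {V : Type*} {G : SimpleGraph V} {A : Set V} {v : V} (hv : v ∈ A)
    (hf : IsFullVertex G v) : IsCDS G A := by
  refine ⟨fun u hu => ⟨v, hv, hf u (fun e => hu (e ▸ hv))⟩, ?_⟩
  have : Nonempty A := ⟨⟨v, hv⟩⟩
  have key : ∀ x : A, (G.induce A).Reachable ⟨v, hv⟩ x := by
    intro x
    by_cases h : x.1 = v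
    · have : x = ⟨v, hv⟩ := Subtype.ext h
      rw [this]
    · exact Adj.reachable (hf x.1 h)
  exact ⟨fun x y => (key x).symm.trans (key y)⟩

lemma case_partition {V W : Type*} [Finite V] [Finite W] [Nontrivial V] [Nontrivial W]
    (G : SimpleGraph V) (H : SimpleGraph W) (hH : H.Connected)
    (Φ : Set (Set V)) (hΦ : IsCCPartition G Φ) :
    Φ.ncard + {v | IsFullVertex G v}.ncard ≤ CC (G.boxProd H) := by
  classical
  obtain ⟨w0, w1, hw⟩ := exists_pair_ne W
  obtain ⟨g, hg, hfib⟩ := exists_label Φ hΦ.1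
  have hmem : ∀ v (A : Φ), g v = A ↔ v ∈ A.1 := by
    intro v A
    rw [← hfib A]
    rfl
  have hfull : ∀ v, IsFullVertex G v → (g v).1 = {v} := by
    intro v hv
    have hvm : v ∈ (g v).1 := (hmem v _).1 rfl
    rcases hΦ.2 (g v).1 (g v).2 with ⟨u, hu, -⟩ | ⟨B, -, -, -, h1, -⟩
    · rw [hu] at hvm ⊢
      have : v = u := hvm
      rw [this]
    · exact absurd (isCDS_of_full hvm hv) h1
  let F : Set V := {v | IsFullVertex G v}
  let f : V × W → Φ ⊕ F := fun x =>
    if h : IsFullVertex G x.1 ∧ x.2 = w0 then Sum.inr ⟨x.1, h.1⟩ else Sum.inl (g x.1)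
  have hinr : ∀ x (v : F), f x = Sum.inr v ↔ x.1 = v.1 ∧ x.2 = w0 := by
    rintro x ⟨v, hv⟩
    by_cases h : IsFullVertex G x.1 ∧ x.2 = w0
    · simp [f, h, Subtype.ext_iff]
    · have hn : f x = Sum.inl (g x.1) := dif_neg h
      rw [hn]
      constructor
      · intro h
        cases h
      · rintro ⟨h1, h2⟩
        have h1 : x.1 = v := h1
        exact absurd ⟨h1 ▸ hv, h2⟩ h
  have hinl : ∀ x (A : Φ), f x = Sum.inl A ↔ x.1 ∈ A.1 ∧ ¬ (IsFullVertex G x.1 ∧ x.2 = w0) := by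
    intro x A
    by_cases h : IsFullVertex G x.1 ∧ x.2 = w0
    · simp [f, h]
    · have hn : f x = Sum.inl (g x.1) := dif_neg h
      rw [hn, Sum.inl.injEq, hmem]
      tauto
  have hsurj : Function.Surjective f := by
    rintro (A | v)
    · obtain ⟨v, rfl⟩ := hg A
      refine ⟨(v, w1), (hinl _ _).2 ⟨(hmem _ _).1 rfl, fun h => hw h.2.symm⟩⟩
    · exact ⟨(v.1, w0), (hinr _ _).2 ⟨rfl, rfl⟩⟩
  -- the two halves of a full column
  have hcol : ∀ v : F, ¬ IsCDS (G.boxProd H) (f ⁻¹' {Sum.inr v}) ∧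
      ¬ IsCDS (G.boxProd H) (f ⁻¹' {Sum.inl (g v.1)}) ∧
      IsCDS (G.boxProd H) (f ⁻¹' {Sum.inr v} ∪ f ⁻¹' {Sum.inl (g v.1)}) := by
    rintro ⟨v, hv⟩
    have hv' : IsFullVertex G v := hv
    obtain ⟨v', hne⟩ := exists_ne v
    refine ⟨?_, ?_, ?_⟩
    · refine not_isCDS_slice (w := w1) hne (fun x hx => ((hinr x _).1 hx).1) ?_
      intro h
      exact hw ((hinr _ _).1 h).2.symm
    · refine not_isCDS_slice (w := w0) hne (fun x hx => ?_) ?_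
      · have := ((hinl x _).1 hx).1
        rw [hfull v hv'] at this
        exact this
      · intro h
        exact ((hinl _ _).1 h).2 ⟨hv', rfl⟩
    · have hc := isCDS_cyl hH (isCDS_of_full (Set.mem_singleton v) hv')
      convert hc using 1
      ext x
      simp only [Set.mem_union, Set.mem_preimage, Set.mem_singleton_iff, hinr, hinl,
        hfull v hv']
      constructor
      · rintro (h | h)
        · exact h.1
        · exact h.1
      · intro h
        rw [h]
        tauto
  have hbig : ∀ A : Φ, ¬ IsCDS G A.1 → f ⁻¹' {Sum.inl A} = Prod.fst ⁻¹' A.1 := by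
    intro A hA
    ext x
    simp only [Set.mem_preimage, Set.mem_singleton_iff, hinl]
    constructor
    · exact fun h => h.1
    · exact fun h => ⟨h, fun h' => hA (isCDS_of_full h h'.1)⟩
  have hcard : Φ.ncard + F.ncard = Nat.card (Φ ⊕ F) := by
    rw [Nat.card_sum, Nat.card_coe_set_eq, Nat.card_coe_set_eq]
  change Φ.ncard + F.ncard ≤ _
  rw [hcard]
  refine cc_ge_of_label _ f hsurj ?_
  rintro (A | v)
  · right
    rcases hΦ.2 A.1 A.2 with ⟨v, hv, hvf⟩ | ⟨B, hB, hne, -, h1, h2, h3⟩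
    · have hA : A = g v := ((hmem v A).2 (by rw [hv]; rfl)).symm
      subst hA
      obtain ⟨a, b, c⟩ := hcol ⟨v, hvf⟩
      refine ⟨Sum.inr ⟨v, hvf⟩, by simp, b, a, ?_⟩
      rw [Set.union_comm]
      exact c
    · refine ⟨Sum.inl ⟨B, hB⟩, ?_, ?_⟩
      · intro h
        exact hne (congrArg Subtype.val (Sum.inl.inj h))
      · rw [hbig A h1, hbig ⟨B, hB⟩ h2]
        exact ⟨fun h => h1 (isCDS_of_cyl h), fun h => h2 (isCDS_of_cyl h), isCDS_cyl hH h3⟩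
  · right
    exact ⟨Sum.inl (g v.1), by simp, hcol v⟩

lemma case_full {V W : Type*} [Finite V] [Finite W] [Nontrivial V] [Nontrivial W]
    (G : SimpleGraph V) (H : SimpleGraph W) (hH : H.Connected)
    (v0 r0 : V) (hv0 : IsFullVertex G v0) (hr0 : ¬ IsFullVertex G r0) :
    {v | IsFullVertex G v}.ncard ≤ CC (G.boxProd H) := by
  classical
  obtain ⟨w0, w1, hw⟩ := exists_pair_ne W
  let F : Set V := {v | IsFullVertex G v}
  let f : V × W → F × Prop := fun x =>
    if h : IsFullVertex G x.1 then (⟨x.1, h⟩, x.2 = w0) else (⟨v0, hv0⟩, x.2 ≠ w0)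
  have hf : ∀ x (v : F) (b : Prop), f x = (v, b) ↔
      (x.1 = v.1 ∧ (x.2 = w0 ↔ b)) ∨
        (¬ IsFullVertex G x.1 ∧ v.1 = v0 ∧ (x.2 ≠ w0 ↔ b)) := by
    rintro x ⟨v, hv⟩ b
    by_cases h : IsFullVertex G x.1
    · have hn : f x = (⟨x.1, h⟩, x.2 = w0) := dif_pos h
      rw [hn, Prod.mk.injEq, Subtype.mk.injEq, eq_iff_iff]
      tauto
    · have hn : f x = (⟨v0, hv0⟩, x.2 ≠ w0) := dif_neg h
      rw [hn, Prod.mk.injEq, Subtype.mk.injEq, eq_iff_iff]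
      have hx : x.1 ≠ v := by
        rintro rfl
        exact h hv
      constructor
      · rintro ⟨h1, h2⟩
        exact Or.inr ⟨h, h1.symm, h2⟩
      · rintro (h' | h')
        · exact absurd h'.1 hx
        · exact ⟨h'.2.1.symm, h'.2.2⟩
  have hsel : ∀ b : Prop, ∃ w, w = w0 ↔ b := by
    intro b
    by_cases hb : b
    · exact ⟨w0, by simp [hb]⟩
    · exact ⟨w1, by simp [hb, hw.symm]⟩
  have hsurj : Function.Surjective f := by
    rintro ⟨v, b⟩
    obtain ⟨w, hwb⟩ := hsel b
    exact ⟨(v.1, w), (hf _ _ _).2 (Or.inl ⟨rfl, hwb⟩)⟩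
  have hnot : ∀ (v : F) (b : Prop), ¬ IsCDS (G.boxProd H) (f ⁻¹' {(v, b)}) := by
    intro v b
    by_cases hv : v.1 = v0
    · rintro ⟨-, hc⟩
      obtain ⟨w, hwb⟩ := hsel b
      obtain ⟨w', hwb'⟩ := hsel (¬ b)
      have m1 : (v.1, w) ∈ f ⁻¹' {(v, b)} := (hf _ _ _).2 (Or.inl ⟨rfl, hwb⟩)
      have m2 : (r0, w') ∈ f ⁻¹' {(v, b)} :=
        (hf _ _ _).2 (Or.inr ⟨hr0, hv, by
          change ¬ (w' = w0) ↔ b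
          rw [hwb', not_not]⟩)
      have hr := hc.preconnected ⟨_, m1⟩ ⟨_, m2⟩
      have hend := reach_invariant
        (p := fun z : (f ⁻¹' {(v, b)} : Set (V × W)) => z.1.1 = v.1) ?_ hr rfl
      · have hend : r0 = v.1 := hend
        exact hr0 (hend ▸ v.2)
      · rintro ⟨⟨c, y⟩, hc⟩ ⟨⟨d, z⟩, hd⟩ hadj hcv
        have hcv : c = v.1 := hcv
        change d = v.1
        have hadj : (G.boxProd H).Adj (c, y) (d, z) := hadj
        rw [boxProd_adj] at hadj
        rcases hadj with h | h
        · have hyz : y = z := h.2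
          subst hyz
          have hvF : IsFullVertex G v.1 := v.2
          rcases (hf _ _ _).1 hc with h1 | h1
          · rcases (hf _ _ _).1 hd with h2 | h2
            · exact h2.1
            · have e1 : y = w0 ↔ b := h1.2
              have e2 : ¬ (y = w0) ↔ b := h2.2.2
              tauto
          · exact absurd (hcv ▸ hvF) h1.1
        · have : c = d := h.2
          exact this ▸ hcv
    · obtain ⟨w, hwb⟩ := hsel (¬ b)
      obtain ⟨v', hne⟩ := exists_ne v.1
      refine not_isCDS_slice (w := w) hne (fun x hx => ?_) ?_
      · rcases (hf _ _ _).1 hx with h | h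
        · exact h.1
        · exact absurd h.2.1 hv
      · intro h
        rcases (hf _ _ _).1 h with h | h
        · have e : w = w0 ↔ b := h.2
          tauto
        · exact hv h.2.1
  have hle : F.ncard ≤ Nat.card (F × Prop) := by
    rw [Nat.card_prod, Nat.card_coe_set_eq]
    exact Nat.le_mul_of_pos_right _ Nat.card_pos
  refine hle.trans (cc_ge_of_label _ f hsurj ?_)
  rintro ⟨v, b⟩
  right
  refine ⟨(v, ¬ b), ?_, hnot _ _, hnot _ _, ?_⟩
  · intro h
    have := (Prod.mk.inj h).2
    simp at this
  · have hc : IsCDS G {x | x = v.1 ∨ (¬ IsFullVertex G x ∧ v.1 = v0)} :=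
      isCDS_of_full (Or.inl rfl) v.2
    convert isCDS_cyl hH hc using 1
    ext x
    simp only [Set.mem_union, Set.mem_preimage, Set.mem_singleton_iff, hf, Set.mem_ofPred_eq]
    tauto

lemma singleton_partition {V : Type*} (G : SimpleGraph V) (h : ∀ v, IsFullVertex G v) :
    ∃ Φ, IsCCPartition G Φ := by
  refine ⟨Set.range (fun v => {v}), ⟨?_, ?_⟩, ?_⟩
  · rintro ⟨v, hv⟩
    exact Set.singleton_ne_empty v hv
  · intro a
    refine ⟨{a}, ⟨⟨a, rfl⟩, rfl⟩, ?_⟩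
    rintro _ ⟨⟨b, rfl⟩, hb⟩
    have : a = b := hb
    rw [this]
  · rintro _ ⟨v, rfl⟩
    exact Or.inl ⟨v, rfl, h v⟩

lemma cc_boxProd_left {V W : Type*} [Finite V] [Finite W] [Nontrivial V] [Nontrivial W]
    (G : SimpleGraph V) (H : SimpleGraph W) (hH : H.Connected) :
    CC G + {v | IsFullVertex G v}.ncard ≤ CC (G.boxProd H) := by
  rcases cc_cases G with h | ⟨Φ, hΦ, hn⟩
  · rw [h, zero_add]
    by_cases hall : ∀ v, IsFullVertex G v
    · obtain ⟨Φ, hΦ⟩ := singleton_partition G hall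
      exact le_trans (Nat.le_add_left _ _) (case_partition G H hH Φ hΦ)
    · push Not at hall
      obtain ⟨r0, hr0⟩ := hall
      rcases Set.eq_empty_or_nonempty {v | IsFullVertex G v} with he | ⟨v0, hv0⟩
      · rw [he]
        simp
      · exact case_full G H hH v0 r0 hv0 hr0
  · rw [← hn]
    exact case_partition G H hH Φ hΦ

/-- For connected graphs `G`, `H`, each on at least two vertices,
`CC(G □ H) ≥ max (CC(G) + k_G) (CC(H) + k_H)` where `k_G`, `k_H` count full vertices. -/
theorem cc_boxProd_ge_max {V W : Type*} [Fintype V] [Fintype W]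
    (G : SimpleGraph V) (H : SimpleGraph W)
    (hG : G.Connected) (hH : H.Connected)
    (hV : 2 ≤ Fintype.card V) (hW : 2 ≤ Fintype.card W) :
    max (CC G + {v | IsFullVertex G v}.ncard) (CC H + {w | IsFullVertex H w}.ncard)
      ≤ CC (G.boxProd H) := by
  have : Nontrivial V := Fintype.one_lt_card_iff_nontrivial.1 hV
  have : Nontrivial W := Fintype.one_lt_card_iff_nontrivial.1 hW
  exact max_le (cc_boxProd_left G H hH)
    ((cc_boxProd_left H G hG).trans (cc_le_of_iso (boxProdComm G H)))
end

section
/- Let G and H be finite simple graphs of orders n ≥ 2 and m ≥ 2, respectively. If G has a full vertex u such that G − u is connected, and H has a full vertex v such that H − v is connected, then the Cartesian product satisfies CC(G □ H) ≥ m + n − 1. -/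
open SimpleGraph

lemma le_CC_of_labeling {α ι : Type*} [Finite α] [Fintype ι] (G : SimpleGraph α) (f : α → ι)
    (hf : Function.Surjective f)
    (h : ∀ i, ∃ j, j ≠ i ∧ IsConnCoalition G (f ⁻¹' {i}) (f ⁻¹' {j})) :
    Fintype.card ι ≤ CC G := by
  have hinj : Function.Injective (fun i : ι => f ⁻¹' {i}) := by
    intro i j hij
    obtain ⟨a, rfl⟩ := hf i
    have : a ∈ f ⁻¹' {j} := by
      have h1 : a ∈ f ⁻¹' {f a} := rfl
      exact (show f ⁻¹' {f a} = f ⁻¹' {j} from hij) ▸ h1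
    exact this
  apply le_csSup
  · refine ⟨Nat.card (Set α), ?_⟩
    rintro n ⟨Φ, -, rfl⟩
    exact Set.ncard_le_card Φ
  · refine ⟨Set.range (fun i : ι => f ⁻¹' {i}), ⟨⟨?_, ?_⟩, ?_⟩, ?_⟩
    · rintro ⟨i, hi⟩
      obtain ⟨a, ha⟩ := hf i
      have h1 : a ∈ f ⁻¹' {i} := ha
      rw [show f ⁻¹' {i} = ∅ from hi] at h1
      exact h1
    · intro a
      refine ⟨f ⁻¹' {f a}, ⟨⟨f a, rfl⟩, rfl⟩, ?_⟩
      rintro _ ⟨⟨i, rfl⟩, hi⟩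
      have : f a = i := hi
      subst this
      rfl
    · rintro _ ⟨i, rfl⟩
      right
      obtain ⟨j, hj, hc⟩ := h i
      exact ⟨_, ⟨j, rfl⟩, fun e => hj (hinj e), hc⟩
    · rw [← Set.image_univ, Set.ncard_image_of_injective _ hinj, Set.ncard_univ,
        Nat.card_eq_fintype_card]

lemma induce_insert_conn {α : Type*} (G : SimpleGraph α) {C : Set α} {a b : α}
    (hC : (G.induce C).Connected) (ha : a ∈ C) (hab : G.Adj a b) :
    (G.induce (insert b C)).Connected := by
  have h2 := induce_union_connected (induce_pair_connected_of_adj hab).preconnected hC.preconnected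
    ⟨a, by simp, ha⟩
  have : ({a, b} ∪ C : Set α) = insert b C := by
    ext z
    simp only [Set.mem_union, Set.mem_insert_iff, Set.mem_singleton_iff]
    constructor
    · rintro ((rfl | h) | h)
      · exact Or.inr ha
      · exact Or.inl h
      · exact Or.inr h
    · rintro (h | h)
      · exact Or.inl (Or.inr h)
      · exact Or.inr h
  rwa [this] at h2

lemma core_conn {V W : Type*} (G : SimpleGraph V) (H : SimpleGraph W) (u : V) (v : W)
    (hGu : (G.induce {x | x ≠ u}).Connected) (hHv : (H.induce {y | y ≠ v}).Connected) :
    ((G.boxProd H).induce {p : V × W | p.1 ≠ u ∧ p.2 ≠ v}).Connected := by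
  have h := hGu.boxProd hHv
  let φ : ((G.induce {x | x ≠ u}).boxProd (H.induce {y | y ≠ v})) →g
      ((G.boxProd H).induce {p : V × W | p.1 ≠ u ∧ p.2 ≠ v}) :=
    { toFun := fun p => ⟨(p.1.1, p.2.1), p.1.2, p.2.2⟩
      map_rel' := by
        rintro ⟨⟨a, ha⟩, ⟨b, hb⟩⟩ ⟨⟨c, hc⟩, ⟨d, hd⟩⟩ hadj
        simpa [boxProd_adj] using hadj }
  refine h.map φ ?_
  rintro ⟨⟨a, b⟩, ha, hb⟩
  exact ⟨(⟨a, ha⟩, ⟨b, hb⟩), rfl⟩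

open Classical in
/-- The labeling: core ↦ none, arms ↦ themselves, centre ↦ t. -/
noncomputable def lab {V W : Type*} (u : V) (v : W) (t : {x : V // x ≠ u} ⊕ {y : W // y ≠ v})
    (p : V × W) : Option ({x : V // x ≠ u} ⊕ {y : W // y ≠ v}) :=
  if hx : p.1 ≠ u then
    if p.2 ≠ v then none else some (Sum.inl ⟨p.1, hx⟩)
  else if hy : p.2 ≠ v then some (Sum.inr ⟨p.2, hy⟩) else some t

lemma main_aux {V W : Type*} [Fintype V] [Fintype W]
    (G : SimpleGraph V) (H : SimpleGraph W)
    (u : V) (hu : IsFullVertex G u) (hGu : (G.induce {x | x ≠ u}).Connected)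
    (v : W) (hv : IsFullVertex H v) (hHv : (H.induce {y | y ≠ v}).Connected)
    (t : {x : V // x ≠ u} ⊕ {y : W // y ≠ v})
    (ht : ¬ IsDomSet (G.boxProd H) (lab u v t ⁻¹' {some t})) :
    Fintype.card V + Fintype.card W - 1 ≤ CC (G.boxProd H) := by
  classical
  obtain ⟨x1, hx1⟩ : ∃ x, x ≠ u := by obtain ⟨⟨x, hx⟩⟩ := hGu.nonempty; exact ⟨x, hx⟩
  obtain ⟨y1, hy1⟩ : ∃ y, y ≠ v := by obtain ⟨⟨x, hx⟩⟩ := hHv.nonempty; exact ⟨x, hx⟩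
  have hcard : Fintype.card (Option ({x : V // x ≠ u} ⊕ {y : W // y ≠ v}))
      = Fintype.card V + Fintype.card W - 1 := by
    have h1 : 0 < Fintype.card V := Fintype.card_pos_iff.2 ⟨u⟩
    have h2 : 0 < Fintype.card W := Fintype.card_pos_iff.2 ⟨v⟩
    rw [Fintype.card_option, Fintype.card_sum]
    simp only [ne_eq, Fintype.card_subtype_compl, Fintype.card_subtype_eq]
    omega
  rw [← hcard]
  have hnone : lab u v t ⁻¹' {none} = {p : V × W | p.1 ≠ u ∧ p.2 ≠ v} := by
    ext p; simp only [lab, Set.mem_preimage, Set.mem_singleton_iff, Set.mem_ofPred_eq]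
    split_ifs <;> simp_all
  have hinl : ∀ x : {x : V // x ≠ u}, lab u v t (x.1, v) = some (Sum.inl x) := by
    intro x; simp [lab, x.2]
  have hinr : ∀ y : {y : W // y ≠ v}, lab u v t (u, y.1) = some (Sum.inr y) := by
    intro y; simp [lab, y.2]
  have hctr : lab u v t (u, v) = some t := by simp [lab]
  -- representative of a class
  have hcls : ∀ s, ∃ q : V × W, q ≠ (u, v) ∧ (G.boxProd H).Adj q (u, v) ∧
      (∃ c, c.1 ≠ u ∧ c.2 ≠ v ∧ (G.boxProd H).Adj c q) ∧
      (∃ d, d ≠ q ∧ d ≠ (u, v) ∧ ¬ (G.boxProd H).Adj q d ∧ ¬ IsDomSet (G.boxProd H) {q}) ∧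
      lab u v t ⁻¹' {some s} = if s = t then {(u, v), q} else {q} := by
    rintro (⟨x, hx⟩ | ⟨y, hy⟩)
    · have hnd : ¬ (G.boxProd H).Adj (x, v) (u, y1) := by
        simp [boxProd_adj, hx, hy1.symm]
      refine ⟨(x, v), by simp [hx], ?_, ⟨(x, y1), hx, hy1, ?_⟩,
        ⟨(u, y1), by simp [hy1], by simp [hy1], hnd, ?_⟩, ?_⟩
      · simp [boxProd_adj, (hu x hx).symm]
      · simp [boxProd_adj, (hv y1 hy1).symm]
      · intro hd
        obtain ⟨q, hq, ha⟩ := hd (u, y1) (by simp [hy1])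
        rw [Set.mem_singleton_iff] at hq
        exact hnd (hq ▸ ha)
      · ext ⟨a, b⟩
        by_cases ha : a = u <;> by_cases hb : b = v <;> split_ifs with hs <;>
          simp [lab, ha, hb, Ne.symm hx] <;> first | (exact hs.symm) | (intro h; exact hs h.symm)
    · have hnd : ¬ (G.boxProd H).Adj (u, y) (x1, v) := by
        simp [boxProd_adj, hy, hx1.symm]
      refine ⟨(u, y), by simp [hy], ?_, ⟨(x1, y), hx1, hy, ?_⟩,
        ⟨(x1, v), by simp [hx1], by simp [hx1], hnd, ?_⟩, ?_⟩
      · simp [boxProd_adj, (hv y hy).symm]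
      · simp [boxProd_adj, (hu x1 hx1).symm]
      · intro hd
        obtain ⟨q, hq, ha⟩ := hd (x1, v) (by simp [hx1])
        rw [Set.mem_singleton_iff] at hq
        exact hnd (hq ▸ ha)
      · ext ⟨a, b⟩
        by_cases ha : a = u <;> by_cases hb : b = v <;> split_ifs with hs <;>
          simp [lab, ha, hb, Ne.symm hy] <;> first | (exact hs.symm) | (intro h; exact hs h.symm)
  have hcore := core_conn G H u v hGu hHv
  have hdisj : ∀ i j, i ≠ j → Disjoint (lab u v t ⁻¹' {i}) (lab u v t ⁻¹' {j}) := by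
    intro i j hij
    exact Disjoint.preimage _ (by simpa using hij)
  have hCn : ¬ IsCDS (G.boxProd H) (lab u v t ⁻¹' {none}) := by
    rintro ⟨hd, -⟩
    obtain ⟨⟨a, b⟩, hm, ha⟩ := hd (u, v) (by rw [hnone]; simp)
    rw [hnone] at hm
    simp only [Set.mem_ofPred_eq] at hm
    simp [boxProd_adj, hm.1, hm.2] at ha
  have hSn : ∀ s, ¬ IsCDS (G.boxProd H) (lab u v t ⁻¹' {some s}) := by
    rintro s ⟨hd, -⟩
    by_cases hs : s = t
    · exact ht (hs ▸ hd)
    · obtain ⟨q, -, -, -, ⟨d, -, -, -, hnd⟩, he⟩ := hcls s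
      rw [he, if_neg hs] at hd
      exact hnd hd
  have hU : ∀ s, IsCDS (G.boxProd H) (lab u v t ⁻¹' {none} ∪ lab u v t ⁻¹' {some s}) := by
    intro s
    obtain ⟨q, hq, hqa, ⟨c, hc1, hc2, hca⟩, -, he⟩ := hcls s
    have hqm : q ∈ lab u v t ⁻¹' {some s} := by rw [he]; split_ifs <;> simp
    constructor
    · rintro ⟨a, b⟩ hab
      rw [hnone] at hab ⊢
      by_cases ha : a = u <;> by_cases hb : b = v
      · subst ha hb
        exact ⟨q, Or.inr hqm, hqa⟩
      · subst ha
        exact ⟨(x1, b), Or.inl ⟨hx1, hb⟩, by simp [boxProd_adj, (hu x1 hx1).symm]⟩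
      · subst hb
        exact ⟨(a, y1), Or.inl ⟨ha, hy1⟩, by simp [boxProd_adj, (hv y1 hy1).symm]⟩
      · exact absurd (Or.inl ⟨ha, hb⟩) hab
    · have h1 := induce_insert_conn (G.boxProd H) hcore (a := c) ⟨hc1, hc2⟩ hca
      rw [hnone, he]
      by_cases hs : s = t
      · rw [if_pos hs]
        have h2 := induce_insert_conn (G.boxProd H) h1 (a := q) (by simp) hqa
        rw [Set.union_insert, Set.union_singleton]
        exact h2
      · rw [if_neg hs, Set.union_singleton]
        exact h1
  apply le_CC_of_labeling (G.boxProd H) (lab u v t)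
  · rintro (_ | x | y)
    · exact ⟨(x1, y1), by simp [lab, hx1, hy1]⟩
    · exact ⟨_, hinl x⟩
    · exact ⟨_, hinr y⟩
  · rintro (_ | s)
    · exact ⟨some t, by simp, hdisj _ _ (by simp), hCn, hSn t, hU t⟩
    · exact ⟨none, by simp, hdisj _ _ (by simp), hSn s, hCn, by
        rw [Set.union_comm]; exact hU s⟩

lemma adj_of_card_two {V : Type*} [Fintype V] (G : SimpleGraph V) (hn : Fintype.card V ≤ 2)
    (u : V) (hu : IsFullVertex G u) (a b : V) (hab : a ≠ b) : G.Adj a b := by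
  by_cases ha : a = u
  · subst ha; exact hu b hab.symm
  by_cases hb : b = u
  · subst hb; exact (hu a hab).symm
  have : 2 < Fintype.card V := Fintype.two_lt_card_iff.2 ⟨u, a, b, Ne.symm ha, Ne.symm hb, hab⟩
  omega

/-- If `G` (order `n ≥ 2`) has a full vertex `u` with `G - u` connected and
`H` (order `m ≥ 2`) has a full vertex `v` with `H - v` connected, then
`CC(G □ H) ≥ m + n - 1`. -/
theorem cc_boxProd_ge_card {V W : Type*} [Fintype V] [Fintype W]
    (G : SimpleGraph V) (H : SimpleGraph W)
    (hn : 2 ≤ Fintype.card V) (hm : 2 ≤ Fintype.card W)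
    (u : V) (hu : IsFullVertex G u) (hGu : (G.induce {x | x ≠ u}).Connected)
    (v : W) (hv : IsFullVertex H v) (hHv : (H.induce {y | y ≠ v}).Connected) :
    Fintype.card V + Fintype.card W - 1 ≤ CC (G.boxProd H) := by
  classical
  obtain ⟨x1, hx1⟩ : ∃ x, x ≠ u := by obtain ⟨⟨x, hx⟩⟩ := hGu.nonempty; exact ⟨x, hx⟩
  obtain ⟨y1, hy1⟩ : ∃ y, y ≠ v := by obtain ⟨⟨x, hx⟩⟩ := hHv.nonempty; exact ⟨x, hx⟩
  by_cases hn3 : 2 < Fintype.card V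
  · obtain ⟨x2, hx2⟩ : ∃ x2, x2 ∉ ({u, x1} : Finset V) := by
      by_contra! hcon
      have h1 := Finset.card_le_card (fun x _ => hcon x : (Finset.univ : Finset V) ⊆ {u, x1})
      have h2 := Finset.card_le_two (a := u) (b := x1)
      rw [Finset.card_univ] at h1
      omega
    simp only [Finset.mem_insert, Finset.mem_singleton, not_or] at hx2
    refine main_aux G H u hu hGu v hv hHv (Sum.inl ⟨x1, hx1⟩) ?_
    intro hd
    obtain ⟨⟨a, b⟩, hm, ha⟩ := hd (x2, y1) (by simp [lab, hx2, hy1])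
    by_cases h1 : a = u <;> by_cases h2 : b = v <;> simp [lab, h1, h2] at hm
    · subst h1 h2; simp [boxProd_adj, Ne.symm hx2.1, Ne.symm hy1] at ha
    · subst hm h2; simp [boxProd_adj, Ne.symm hx2.2, Ne.symm hy1] at ha
  by_cases hm3 : 2 < Fintype.card W
  · obtain ⟨y2, hy2⟩ : ∃ y2, y2 ∉ ({v, y1} : Finset W) := by
      by_contra! hcon
      have h1 := Finset.card_le_card (fun x _ => hcon x : (Finset.univ : Finset W) ⊆ {v, y1})
      have h2 := Finset.card_le_two (a := v) (b := y1)
      rw [Finset.card_univ] at h1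
      omega
    simp only [Finset.mem_insert, Finset.mem_singleton, not_or] at hy2
    refine main_aux G H u hu hGu v hv hHv (Sum.inr ⟨y1, hy1⟩) ?_
    intro hd
    obtain ⟨⟨a, b⟩, hm, ha⟩ := hd (x1, y2) (by simp [lab, hy2, hx1])
    by_cases h1 : a = u <;> by_cases h2 : b = v <;> simp [lab, h1, h2] at hm
    · subst h1 h2; simp [boxProd_adj, Ne.symm hy2.1, Ne.symm hx1] at ha
    · subst hm h1; simp [boxProd_adj, Ne.symm hy2.2, Ne.symm hx1] at ha
  have hG := adj_of_card_two G (by omega) u hu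
  have hH := adj_of_card_two H (by omega) v hv
  have hV : ∀ a : V, ∃ b, b ≠ a := fun a =>
    haveI := Fintype.one_lt_card_iff_nontrivial.1 (show 1 < Fintype.card V by omega)
    exists_ne a
  have hW : ∀ a : W, ∃ b, b ≠ a := fun a =>
    haveI := Fintype.one_lt_card_iff_nontrivial.1 (show 1 < Fintype.card W by omega)
    exists_ne a
  have hkey := le_CC_of_labeling (G.boxProd H) (id : V × W → V × W) Function.surjective_id
  rw [Fintype.card_prod] at hkey
  refine le_trans ?_ (hkey ?_)
  · have h1 : Fintype.card V = 2 := by omega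
    have h2 : Fintype.card W = 2 := by omega
    rw [h1, h2]; norm_num
  have hsing : ∀ p : V × W, ¬ IsCDS (G.boxProd H) {p} := by
    rintro ⟨a, b⟩ ⟨hd, -⟩
    obtain ⟨a', ha⟩ := hV a
    obtain ⟨b', hb⟩ := hW b
    obtain ⟨q, hq, hadj⟩ := hd (a', b') (by simp [ha])
    rw [Set.mem_singleton_iff] at hq
    subst hq
    simp [boxProd_adj, Ne.symm ha, Ne.symm hb] at hadj
  rintro ⟨a, b⟩
  obtain ⟨a', ha⟩ := hV a
  refine ⟨(a', b), by simp [ha], ?_⟩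
  simp only [Set.preimage_id]
  refine ⟨by simp [Ne.symm ha], hsing _, hsing _, ?_, ?_⟩
  · rintro ⟨c, d⟩ hcd
    have hc : c = a ∨ c = a' := by
      by_contra! hcon
      have : 2 < Fintype.card V :=
        Fintype.two_lt_card_iff.2 ⟨c, a, a', hcon.1, hcon.2, Ne.symm ha⟩
      omega
    have hd : b ≠ d := by
      rintro rfl
      rcases hc with rfl | rfl <;> simp at hcd
    rcases hc with rfl | rfl
    · exact ⟨(c, b), by simp, by simp [boxProd_adj, hH b d hd]⟩
    · exact ⟨(c, b), by simp, by simp [boxProd_adj, hH b d hd]⟩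
  · have : ({(a, b)} ∪ {(a', b)} : Set (V × W)) = {(a, b), (a', b)} := rfl
    rw [this]
    exact induce_pair_connected_of_adj (by simp [boxProd_adj, hG a a' (Ne.symm ha)])
end
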